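/- arXiv:1501.05112 — 2 statements merged into one kernel-verified Lean document; each statement's English description precedes it below -/
import Mathlib

section
/- Upper type I estimates away from the origin (Kaplan-type bound): there exists a constant M₀ > 0, depending only on n, p, q, δ, c₁, R and T*, such that every solution as in the context satisfies u(t,x) ≤ M₀ |x|^{−n} (T*−t)^{−α} and v(t,x) ≤ M₀ |x|^{−n} (T*−t)^{−β} for all t ∈ [0,T*) and all x with 0 < |x| ≤ R. -/
open Set Filter Topology

structure KSol (n : ℕ) (R d1 d2 c p q T : ℝ) (u v : ℝ → ℝ → ℝ) : Prop where
  u0 : ∀ t ∈ Ico (0:ℝ) T, ∀ ρ ∈ Icc (0:ℝ) R, 0 ≤ u t ρ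
  v0 : ∀ t ∈ Ico (0:ℝ) T, ∀ ρ ∈ Icc (0:ℝ) R, 0 ≤ v t ρ
  uc : ContinuousOn (Function.uncurry u) (Ico (0:ℝ) T ×ˢ Icc (0:ℝ) R)
  vc : ContinuousOn (Function.uncurry v) (Ico (0:ℝ) T ×ˢ Icc (0:ℝ) R)
  u2 : ∀ t ∈ Ioo (0:ℝ) T, ContDiffOn ℝ 2 (u t) (Ioo (0:ℝ) R)
  v2 : ∀ t ∈ Ioo (0:ℝ) T, ContDiffOn ℝ 2 (v t) (Ioo (0:ℝ) R)
  ut : ∀ ρ ∈ Ioo (0:ℝ) R, ∀ t ∈ Ioo (0:ℝ) T, DifferentiableAt ℝ (fun s => u s ρ) t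
  vt : ∀ ρ ∈ Ioo (0:ℝ) R, ∀ t ∈ Ioo (0:ℝ) T, DifferentiableAt ℝ (fun s => v s ρ) t
  ua : ∀ t ∈ Ico (0:ℝ) T, AntitoneOn (u t) (Icc (0:ℝ) R)
  va : ∀ t ∈ Ico (0:ℝ) T, AntitoneOn (v t) (Icc (0:ℝ) R)
  ue : ∀ t ∈ Ioo (0:ℝ) T, ∀ ρ ∈ Ioo (0:ℝ) R,
        d1 * (deriv (deriv (u t)) ρ + ((n : ℝ) - 1) / ρ * deriv (u t) ρ) + c * (v t ρ) ^ p
          ≤ deriv (fun s => u s ρ) t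
  ve : ∀ t ∈ Ioo (0:ℝ) T, ∀ ρ ∈ Ioo (0:ℝ) R,
        d2 * (deriv (deriv (v t)) ρ + ((n : ℝ) - 1) / ρ * deriv (v t) ρ) + c * (u t ρ) ^ q
          ≤ deriv (fun s => v s ρ) t

theorem KSol.symm {n : ℕ} {R d1 d2 c p q T : ℝ} {u v : ℝ → ℝ → ℝ}
    (S : KSol n R d1 d2 c p q T u v) : KSol n R d2 d1 c q p T v u :=
  ⟨S.v0, S.u0, S.vc, S.uc, S.v2, S.u2, S.vt, S.ut, S.va, S.ua, S.ve, S.ue⟩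

structure KSub (n : ℕ) (d c p a b D : ℝ) (u v U V : ℝ → ℝ → ℝ) : Prop where
  cont : ContinuousOn (Function.uncurry U) (Icc a b ×ˢ Icc (0:ℝ) D)
  init : ∀ r ∈ Icc (0:ℝ) D, U a r < u a r
  bdry : ∀ t ∈ Ioc a b, U t D < u t D
  orig : ∀ t ∈ Ioc a b, (∃ r ∈ Icc (0:ℝ) D, U t 0 < U t r) ∨ U t 0 < u t 0
  ineq : ∀ t ∈ Ioc a b, ∀ r ∈ Ioo (0:ℝ) D, u t r = U t r → V t r ≤ v t r →
    ∃ (Ut Urr : ℝ) (Ur : ℝ → ℝ), HasDerivAt (fun s => U s r) Ut t ∧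
      (∀ y, HasDerivAt (U t) (Ur y) y) ∧ HasDerivAt Ur Urr r ∧
      Ut < d * (Urr + ((n : ℝ) - 1) / r * Ur r) + c * (v t r) ^ p

theorem KSub.triv {n : ℕ} {d c p a b D : ℝ} {u v U V : ℝ → ℝ → ℝ} (hab : a ≤ b) (hD : 0 ≤ D)
    (hc : ContinuousOn (Function.uncurry U) (Icc a b ×ˢ Icc (0:ℝ) D))
    (h : ∀ t ∈ Icc a b, ∀ r ∈ Icc (0:ℝ) D, U t r < u t r) : KSub n d c p a b D u v U V where
  cont := hc
  init := h a ⟨le_rfl, hab⟩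
  bdry t ht := h t ⟨ht.1.le, ht.2⟩ D ⟨hD, le_rfl⟩
  orig t ht := Or.inr (h t ⟨ht.1.le, ht.2⟩ 0 ⟨le_rfl, hD⟩)
  ineq t ht r hr e := absurd e (h t ⟨ht.1.le, ht.2⟩ r ⟨hr.1.le, hr.2.le⟩).ne'

theorem time_le {w : ℝ → ℝ} {a t w' : ℝ} (hat : a < t) (h : HasDerivAt w w' t) (h0 : w t = 0)
    (hw : ∀ s, a ≤ s → s < t → 0 ≤ w s) : w' ≤ 0 := by
  have h1 := hasDerivAt_iff_tendsto_slope.1 h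
  have h2 : Tendsto (slope w t) (𝓝[<] t) (𝓝 w') :=
    h1.mono_left (nhdsWithin_mono _ (fun x hx => ne_of_lt hx))
  refine le_of_tendsto h2 ?_
  have : Ioo a t ∈ 𝓝[<] t := Ioo_mem_nhdsLT hat
  filter_upwards [this] with s hs
  rw [slope_def_field, h0, sub_zero]
  exact div_nonpos_of_nonneg_of_nonpos (hw s hs.1.le hs.2) (by linarith [hs.2])

theorem space_ge {w w1 : ℝ → ℝ} {r w2 : ℝ} (h1 : ∀ᶠ y in 𝓝 r, HasDerivAt w (w1 y) y)
    (h2 : HasDerivAt w1 w2 r) (hm : IsLocalMin w r) : w1 r = 0 ∧ 0 ≤ w2 := by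
  have e0 : w1 r = 0 := hm.hasDerivAt_eq_zero h1.self_of_nhds
  refine ⟨e0, ?_⟩
  by_contra hneg
  push Not at hneg
  have ed : deriv w =ᶠ[𝓝 r] w1 := h1.mono fun y hy => hy.deriv
  have hdd : deriv (deriv w) r = w2 := by rw [ed.deriv_eq, h2.deriv]
  have hmax : IsLocalMax w r := by
    apply isLocalMax_of_deriv_deriv_neg
    · rw [hdd]; exact hneg
    · rw [ed.self_of_nhds, e0]
    · exact h1.self_of_nhds.continuousAt
  have hc : w =ᶠ[𝓝 r] fun _ => w r := by
    filter_upwards [hm, hmax] with y hy hy'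
    exact le_antisymm hy' hy
  have : deriv w =ᶠ[𝓝 r] fun _ => 0 := by
    filter_upwards [hc.eventuallyEq_nhds] with y hy
    rw [hy.deriv_eq]; simp
  rw [this.deriv_eq] at hdd
  simp at hdd
  linarith

theorem KSol.touch {n : ℕ} {R d1 d2 c p q T : ℝ} {u v : ℝ → ℝ → ℝ} (hd1 : 0 < d1)
    (S : KSol n R d1 d2 c p q T u v) {a b D : ℝ} {U V : ℝ → ℝ → ℝ} (ha : 0 ≤ a) (hb : b < T)
    (hDR : D ≤ R) (K : KSub n d1 c p a b D u v U V) {t r : ℝ} (ht : t ∈ Ioc a b)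
    (hr : r ∈ Icc 0 D) (he : u t r = U t r) (hv : V t r ≤ v t r)
    (hx : ∀ y ∈ Icc 0 D, U t y ≤ u t y) (hs : ∀ s, a ≤ s → s < t → U s r ≤ u s r) : False := by
  have hD : 0 ≤ D := hr.1.trans hr.2
  have htT : t ∈ Ico 0 T := ⟨ha.trans ht.1.le, ht.2.trans_lt hb⟩
  have htT' : t ∈ Ioo 0 T := ⟨ha.trans_lt ht.1, ht.2.trans_lt hb⟩
  rcases hr.1.eq_or_lt with h0 | h0
  · subst h0
    rcases K.orig t ht with ⟨y, hy, hyy⟩ | h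
    · have h1 := hx y hy
      have h2 := S.ua t htT ⟨le_rfl, hD.trans hDR⟩ ⟨hy.1, hy.2.trans hDR⟩ hy.1
      linarith
    · linarith
  rcases hr.2.eq_or_lt with h1 | h1
  · subst h1
    linarith [K.bdry t ht]
  have hrR : r ∈ Ioo 0 R := ⟨h0, h1.trans_le hDR⟩
  obtain ⟨Ut, Urr, Ur, k1, k2, k3, k4⟩ := K.ineq t ht r ⟨h0, h1⟩ he hv
  have e1 := time_le (w := fun s => u s r - U s r) ht.1
    ((S.ut r hrR t htT').hasDerivAt.sub k1) (by simp [he])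
    (fun s h h' => by simpa using hs s h h')
  have c2 := S.u2 t htT'
  have cd : ContDiffOn ℝ 1 (deriv (u t)) (Ioo 0 R) := by
    have := (contDiffOn_succ_iff_deriv_of_isOpen (n := 1) isOpen_Ioo).1
      (by simpa [one_add_one_eq_two] using c2)
    exact this.2.2
  have m1 : ∀ᶠ y in 𝓝 r, HasDerivAt (fun y => u t y - U t y) (deriv (u t) y - Ur y) y := by
    filter_upwards [isOpen_Ioo.mem_nhds hrR] with y hy
    exact (((c2.differentiableOn (by norm_num)).differentiableAt
      (isOpen_Ioo.mem_nhds hy)).hasDerivAt).sub (k2 y)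
  have m2 : HasDerivAt (fun y => deriv (u t) y - Ur y) (deriv (deriv (u t)) r - Urr) r :=
    (((cd.differentiableOn (by norm_num)).differentiableAt
      (isOpen_Ioo.mem_nhds hrR)).hasDerivAt).sub k3
  have hmin : IsLocalMin (fun y => u t y - U t y) r := by
    filter_upwards [isOpen_Ioo.mem_nhds (show r ∈ Ioo 0 D from ⟨h0, h1⟩)] with y hy
    have := hx y ⟨hy.1.le, hy.2.le⟩
    simp only [he]; linarith
  obtain ⟨f1, f2⟩ := space_ge m1 m2 hmin
  have g := S.ue t htT' r hrR
  have f3 : deriv (u t) r = Ur r := by linarith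
  rw [f3] at g
  have := mul_nonneg hd1.le f2
  nlinarith

theorem KSol.compare {n : ℕ} {R d1 d2 c p q T : ℝ} {u v : ℝ → ℝ → ℝ} (hd1 : 0 < d1) (hd2 : 0 < d2)
    (S : KSol n R d1 d2 c p q T u v) {a b D : ℝ} {U V : ℝ → ℝ → ℝ} (ha : 0 ≤ a) (hb : b < T)
    (hDR : D ≤ R) (K : KSub n d1 c p a b D u v U V) (K' : KSub n d2 c q a b D v u V U) :
    ∀ t ∈ Icc a b, ∀ r ∈ Icc 0 D, U t r < u t r ∧ V t r < v t r := by
  have hsub : Icc a b ×ˢ Icc 0 D ⊆ Ico 0 T ×ˢ Icc 0 R :=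
    prod_mono (fun t ht => ⟨ha.trans ht.1, ht.2.trans_lt hb⟩) (fun r hr => ⟨hr.1, hr.2.trans hDR⟩)
  set w : ℝ × ℝ → ℝ := fun z => min (Function.uncurry u z - Function.uncurry U z)
    (Function.uncurry v z - Function.uncurry V z) with hwdef
  have hw : ContinuousOn w (Icc a b ×ˢ Icc 0 D) :=
    ContinuousOn.inf (ContinuousOn.sub (S.uc.mono hsub) K.cont)
      (ContinuousOn.sub (S.vc.mono hsub) K'.cont)
  suffices h : ∀ t ∈ Icc a b, ∀ r ∈ Icc 0 D, 0 < w (t, r) by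
    intro t ht r hr
    have := lt_min_iff.1 (h t ht r hr)
    simp only [Function.uncurry] at this
    exact ⟨by linarith, by linarith⟩
  by_contra hcon
  push Not at hcon
  obtain ⟨t1, ht1, r1, hr1, hw1⟩ := hcon
  set B := (Icc a b ×ˢ Icc 0 D) ∩ w ⁻¹' Iic 0 with hB
  have hBc : IsCompact B := by
    have hc : IsCompact (Icc a b ×ˢ Icc 0 D) := isCompact_Icc.prod isCompact_Icc
    exact hc.of_isClosed_subset (hw.preimage_isClosed_of_isClosed hc.isClosed isClosed_Iic)
      inter_subset_left
  obtain ⟨⟨t, r⟩, hz, hmin⟩ := hBc.exists_isMinOn ⟨(t1, r1), ⟨⟨ht1, hr1⟩, hw1⟩⟩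
    continuous_fst.continuousOn
  obtain ⟨⟨htI, hrI⟩, hwz⟩ := hz
  simp only [mem_preimage, mem_Iic] at hwz htI hrI
  have hpos : ∀ s, a ≤ s → s < t → ∀ y ∈ Icc 0 D, 0 < w (s, y) := by
    intro s hs hst y hy
    by_contra hcon
    push Not at hcon
    have := hmin (show ((s, y) : ℝ × ℝ) ∈ B from ⟨⟨⟨hs, hst.le.trans htI.2⟩, hy⟩, hcon⟩)
    simp at this
    linarith
  have hat : a < t := by
    rcases htI.1.eq_or_lt with h | h
    · exfalso
      subst h
      have h1 := K.init r hrI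
      have h2 := K'.init r hrI
      have : 0 < w (a, r) := by
        simp only [hwdef, Function.uncurry]
        exact lt_min (by linarith) (by linarith)
      linarith
    · exact h
  have hnn : ∀ y ∈ Icc 0 D, 0 ≤ w (t, y) := by
    intro y hy
    have hcy : ContinuousWithinAt (fun s => w (s, y)) (Ico a t) t := by
      have h1 : ContinuousWithinAt w (Icc a b ×ˢ Icc 0 D) (t, y) := hw (t, y) ⟨htI, hy⟩
      exact h1.comp (f := fun s => ((s, y) : ℝ × ℝ)) (by fun_prop)
        (fun s hs => ⟨⟨hs.1, hs.2.le.trans htI.2⟩, hy⟩)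
    have : (𝓝[Ico a t] t).NeBot := by
      rw [← mem_closure_iff_nhdsWithin_neBot, closure_Ico hat.ne]
      exact ⟨hat.le, le_rfl⟩
    refine ge_of_tendsto hcy ?_
    filter_upwards [self_mem_nhdsWithin] with s hs
    exact (hpos s hs.1 hs.2 y hy).le
  have hU : ∀ y ∈ Icc 0 D, U t y ≤ u t y := fun y hy => by
    have := (le_min_iff.1 (hnn y hy)).1
    simpa [Function.uncurry] using this
  have hV : ∀ y ∈ Icc 0 D, V t y ≤ v t y := fun y hy => by
    have := (le_min_iff.1 (hnn y hy)).2
    simpa [Function.uncurry] using this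
  have hU' : ∀ s, a ≤ s → s < t → U s r ≤ u s r := fun s h1 h2 => by
    have := (lt_min_iff.1 (hpos s h1 h2 r hrI)).1.le
    simpa [Function.uncurry] using this
  have hV' : ∀ s, a ≤ s → s < t → V s r ≤ v s r := fun s h1 h2 => by
    have := (lt_min_iff.1 (hpos s h1 h2 r hrI)).2.le
    simpa [Function.uncurry] using this
  have hwz' : u t r - U t r ≤ 0 ∨ v t r - V t r ≤ 0 := by
    simpa [hwdef, min_le_iff, Function.uncurry] using hwz
  rcases hwz' with h | h
  · exact S.touch hd1 ha hb hDR K ⟨hat, htI.2⟩ hrI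
      (le_antisymm (by linarith) (hU r hrI)) (hV r hrI) hU hU'
  · exact S.symm.touch hd2 ha hb hDR K' ⟨hat, htI.2⟩ hrI
      (le_antisymm (by linarith) (hV r hrI)) (hU r hrI) hV hV'

theorem shift_ge {n : ℕ} (hn : 1 ≤ n) {r h a : ℝ} (hr : 0 < r) (hh : 0 ≤ h) (ha : 0 ≤ a) :
    -(((n:ℝ) - 1) * a) ≤ ((n:ℝ) - 1) / r * (-(a * (r - h))) := by
  have hn' : (0:ℝ) ≤ (n:ℝ) - 1 := by
    have : (1:ℝ) ≤ n := by exact_mod_cast hn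
    linarith
  have : ((n:ℝ) - 1) / r * (-(a * (r - h))) = -(((n:ℝ) - 1) * a) + ((n:ℝ) - 1) * a * h / r := by
    field_simp; ring
  rw [this]
  have : 0 ≤ ((n:ℝ) - 1) * a * h / r := by positivity
  linarith

theorem KSol.grow {n : ℕ} (hn : 1 ≤ n) {R d1 d2 c p q T : ℝ} {u v : ℝ → ℝ → ℝ}
    (hd1 : 0 < d1) (hd2 : 0 < d2) (hc : 0 < c) (hq : 0 < q)
    (S : KSol n R d1 d2 c p q T u v) {t1 ω l K P : ℝ} (ht1 : 0 ≤ t1) (hω : 0 < ω)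
    (hT : t1 + ω < T) (hl : 0 < l) (hlR : 2 * l ≤ R) (hK : 0 < K) (hP : 0 < P)
    (hu : ∀ t ∈ Icc t1 (t1 + ω), ∀ r ∈ Icc 0 (2 * l), K ≤ u t r)
    (hPK : P * (1 + 2 * n * d2 * ω / l ^ 2) < c * K ^ q) :
    ∀ r ∈ Icc 0 l, P * ω / 2 ≤ v (t1 + ω) r := by
  have hn' : (1:ℝ) ≤ n := by exact_mod_cast hn
  set U : ℝ → ℝ → ℝ := fun _ _ => K / 2 with hU
  set V : ℝ → ℝ → ℝ := fun t r => P * ((t - t1) * (1 - (r - l / 2) ^ 2 / l ^ 2) - ω / 4) with hV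
  have v0 : ∀ t ∈ Icc t1 (t1 + ω), ∀ r ∈ Icc 0 (2 * l), 0 ≤ v t r := fun t ht r hr =>
    S.v0 t ⟨ht1.trans ht.1, ht.2.trans_lt hT⟩ r ⟨hr.1, hr.2.trans hlR⟩
  have K1 : KSub n d1 c p t1 (t1 + ω) (2 * l) u v U V := by
    apply KSub.triv (by linarith) (by linarith)
    · exact continuousOn_const
    · intro t ht r hr
      have := hu t ht r hr
      simp only [hU]; linarith
  have K2 : KSub n d2 c q t1 (t1 + ω) (2 * l) v u V U := by
    constructor
    · apply Continuous.continuousOn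
      simp only [hV, Function.uncurry_def]
      fun_prop
    · intro r hr
      have := v0 t1 ⟨le_rfl, by linarith⟩ r hr
      have h2 : V t1 r = - (P * ω / 4) := by simp only [hV]; ring
      have : 0 < P * ω / 4 := by positivity
      linarith
    · intro t ht
      have h0 := v0 t ⟨ht.1.le, ht.2⟩ (2 * l) ⟨by linarith, le_rfl⟩
      have h2 : V t (2 * l) = - (P * ((t - t1) * (5 / 4) + ω / 4)) := by
        simp only [hV]; field_simp; ring
      have : 0 < P * ((t - t1) * (5 / 4) + ω / 4) := by
        have := ht.1
        have : 0 < t - t1 := by linarith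
        positivity
      linarith
    · intro t ht
      left
      refine ⟨l / 2, ⟨by linarith, by linarith⟩, ?_⟩
      have h1 : V t (l / 2) - V t 0 = P * ((t - t1) / 4) := by
        simp only [hV]; field_simp; ring
      have : 0 < t - t1 := by linarith [ht.1]
      have : 0 < P * ((t - t1) / 4) := by positivity
      linarith
    · intro t ht r hr _ _
      have htt : 0 < t - t1 := by linarith [ht.1]
      have htt' : t - t1 ≤ ω := by linarith [ht.2]
      refine ⟨P * (1 - (r - l / 2) ^ 2 / l ^ 2), -(P * (t - t1) * 2 / l ^ 2),
        fun y => -(P * (t - t1) * 2 / l ^ 2 * (y - l / 2)), ?_, ?_, ?_, ?_⟩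
      · have := ((((hasDerivAt_id t).sub_const t1).mul_const
          (1 - (r - l / 2) ^ 2 / l ^ 2)).sub_const (ω / 4)).const_mul P
        simpa [hV] using this
      · intro y
        have := ((((((((hasDerivAt_id y).sub_const (l / 2)).pow 2).div_const (l ^ 2)).const_sub
          1).const_mul (t - t1)).sub_const (ω / 4)).const_mul P)
        refine this.congr_deriv ?_
        simp only [id, Nat.cast_ofNat]; ring
      · have := (((hasDerivAt_id r).sub_const (l / 2)).const_mul (P * (t - t1) * 2 / l ^ 2)).neg
        exact this.congr_deriv (by ring)
      · have hs := shift_ge hn hr.1 (show 0 ≤ l / 2 by linarith)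
          (show 0 ≤ P * (t - t1) * 2 / l ^ 2 by positivity)
        set A := P * (t - t1) * 2 / l ^ 2 with hA
        have hAle : n * d2 * A ≤ P * (2 * n * d2 * ω / l ^ 2) := by
          have : n * d2 * A = P * (2 * n * d2 * (t - t1) / l ^ 2) := by rw [hA]; ring
          rw [this]; gcongr
        have hu1 := hu t ⟨ht.1.le, ht.2⟩ r ⟨hr.1.le, hr.2.le⟩
        have hu2 : c * K ^ q ≤ c * u t r ^ q := by gcongr
        have h4 : d2 * (-(n * A)) ≤ d2 * (-A + ((n:ℝ) - 1) / r * (-(A * (r - l / 2)))) := by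
          apply mul_le_mul_of_nonneg_left _ hd2.le
          linarith
        have h5 : P * (1 - (r - l / 2) ^ 2 / l ^ 2) ≤ P * 1 := by
          gcongr
          have : 0 ≤ (r - l / 2) ^ 2 / l ^ 2 := by positivity
          linarith
        nlinarith
  intro r hr
  have h := (S.compare hd1 hd2 ht1 hT hlR K1 K2 (t1 + ω) ⟨by linarith, le_rfl⟩ r
    ⟨hr.1, by linarith [hr.2]⟩).2
  refine le_trans ?_ h.le
  simp only [hV]
  have : (r - l / 2) ^ 2 / l ^ 2 ≤ 1 / 4 := by
    rw [div_le_iff₀ (by positivity)]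
    nlinarith [hr.1, hr.2]
  have e : P * ω / 2 = P * (ω * (1 - 1 / 4) - ω / 4) := by ring
  rw [e, add_sub_cancel_left]
  gcongr

theorem blow_const {n : ℕ} (hn : 1 ≤ n) {d α p k c : ℝ} (hd : 0 < d) (hα : 0 < α) (hp : 1 < p)
    (hk : 0 < k) (hc : 0 < c) : ∃ M0 > (0:ℝ), ∀ M ≥ M0, ∀ z : ℝ, 0 ≤ z → z ≤ n →
      α * (Real.exp (-z) - Real.exp (-n)) - z * Real.exp (-z)
        - d * (Real.exp (-z) * (4 * k * z - 2 * k * n))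
        < c * M ^ (p - 1) * (Real.exp (-z) - Real.exp (-n)) ^ p := by
  have hn' : (1:ℝ) ≤ n := by exact_mod_cast hn
  set η := Real.exp (-(n:ℝ)) with hη
  have hη0 : 0 < η := Real.exp_pos _
  set ε := min (Real.exp (-(n / 2 : ℝ)) - η) (η * n / (2 * α)) with hε
  have hε0 : 0 < ε := by
    apply lt_min
    · have : η < Real.exp (-(n / 2 : ℝ)) := Real.exp_lt_exp.2 (by linarith)
      linarith
    · positivity
  set X := (α + 2 * k * n * d + 1) / (c * ε ^ p) with hX
  have hX0 : 0 < X := by positivity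
  refine ⟨X ^ (1 / (p - 1)), by positivity, ?_⟩
  intro M hM z hz hzn
  have hM0 : 0 < M := lt_of_lt_of_le (by positivity) hM
  have hXM : X ≤ M ^ (p - 1) := by
    have : X = (X ^ (1 / (p - 1))) ^ (p - 1) := by
      rw [← Real.rpow_mul hX0.le, one_div_mul_cancel (by linarith), Real.rpow_one]
    rw [this]
    exact Real.rpow_le_rpow (by positivity) hM (by linarith)
  set E := Real.exp (-z) with hE
  have hE0 : 0 < E := Real.exp_pos _
  have hE1 : E ≤ 1 := Real.exp_le_one_iff.2 (by linarith)
  have hEη : η ≤ E := Real.exp_le_exp.2 (by linarith)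
  rcases lt_or_ge (E - η) ε with h | h
  · have h1 : E - η < Real.exp (-(n / 2 : ℝ)) - η := h.trans_le (min_le_left _ _)
    have h2 : E - η < η * n / (2 * α) := h.trans_le (min_le_right _ _)
    have h3 : (n:ℝ) / 2 < z := by
      have : -z < -(n / 2 : ℝ) := Real.exp_lt_exp.1 (by linarith)
      linarith
    have h4 : α * (E - η) < η * n / 2 := by
      have := mul_lt_mul_of_pos_left h2 hα
      have e : α * (η * n / (2 * α)) = η * n / 2 := by field_simp
      linarith
    have h5 : 0 ≤ c * M ^ (p - 1) * (E - η) ^ p := by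
      have : 0 ≤ E - η := by linarith
      positivity
    have h6 : 0 ≤ d * (E * (4 * k * z - 2 * k * n)) := by
      have : 0 ≤ 4 * k * z - 2 * k * n := by nlinarith
      positivity
    nlinarith
  · have h1 : ε ^ p ≤ (E - η) ^ p := Real.rpow_le_rpow hε0.le h (by linarith)
    have h2 : α + 2 * k * n * d + 1 ≤ c * M ^ (p - 1) * (E - η) ^ p := by
      calc α + 2 * k * n * d + 1 = c * X * ε ^ p := by
            rw [hX]; field_simp
        _ ≤ _ := by gcongr
    have h3 : α * (E - η) ≤ α * 1 := by
      apply mul_le_mul_of_nonneg_left _ hα.le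
      linarith
    have h4 : 0 ≤ z * E := by positivity
    have h5 : -(d * (E * (4 * k * z - 2 * k * n))) ≤ 2 * k * n * d := by
      have a1 : 0 ≤ d * (E * (4 * k * z)) := by positivity
      have a2 : d * k * n * E ≤ d * k * n * 1 := by gcongr
      nlinarith
    linarith

noncomputable def bU (M α k η h e : ℝ) (t r : ℝ) : ℝ :=
  M * (e - t) ^ (-α) * (Real.exp (-(k * (r - h) ^ 2 / (e - t))) - η)

theorem bU_sub {n : ℕ} (hn : 1 ≤ n) {R d1 d2 c p q T : ℝ} {u v : ℝ → ℝ → ℝ}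
    (hd1 : 0 < d1) (hc : 0 < c) (hp : 1 < p)
    (S : KSol n R d1 d2 c p q T u v) {t1 σ b l k M α β : ℝ} (hα : 0 < α)
    (hβp : β * p = α + 1) (ht1 : 0 ≤ t1) (hb1 : t1 ≤ b) (hb : b < t1 + σ)
    (hT : t1 + σ < T) (hl : 0 < l) (hk : 0 < k) (hlk : k * l ^ 2 = 4 * n * σ) (hlR : l ≤ R)
    (hM : 0 < M)
    (hMz : ∀ z : ℝ, 0 ≤ z → z ≤ n →
      α * (Real.exp (-z) - Real.exp (-n)) - z * Real.exp (-z)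
        - d1 * (Real.exp (-z) * (4 * k * z - 2 * k * n))
        < c * M ^ (p - 1) * (Real.exp (-z) - Real.exp (-n)) ^ p)
    (hu : ∀ r ∈ Icc 0 l, M * σ ^ (-α) ≤ u t1 r) :
    KSub n d1 c p t1 b l u v (bU M α k (Real.exp (-n)) (l / 2) (t1 + σ))
      (bU M β k (Real.exp (-n)) (l / 2) (t1 + σ)) := by
  have hn' : (1:ℝ) ≤ n := by exact_mod_cast hn
  have hσ : 0 < σ := by linarith
  set η := Real.exp (-(n:ℝ)) with hη
  have hη0 : 0 < η := Real.exp_pos _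
  have u0 : ∀ t ∈ Icc t1 b, ∀ r ∈ Icc 0 l, 0 ≤ u t r := fun t ht r hr =>
    S.u0 t ⟨ht1.trans ht.1, by linarith [ht.2]⟩ r ⟨hr.1, hr.2.trans hlR⟩
  constructor
  · have hne : ∀ z ∈ Icc t1 b ×ˢ Icc 0 l, t1 + σ - z.1 ≠ 0 := by
      intro z hz
      have := hz.1.2
      linarith
    unfold Function.uncurry bU
    apply ContinuousOn.mul
    · apply ContinuousOn.mul continuousOn_const
      apply ContinuousOn.rpow_const (by fun_prop)
      intro z hz; exact Or.inl (hne z hz)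
    · apply ContinuousOn.sub _ continuousOn_const
      apply Real.continuous_exp.comp_continuousOn
      apply ContinuousOn.neg
      exact ContinuousOn.div (by fun_prop) (by fun_prop) hne
  · intro r hr
    refine lt_of_lt_of_le ?_ (hu r hr)
    unfold bU
    rw [add_sub_cancel_left]
    have h1 : Real.exp (-(k * (r - l / 2) ^ 2 / σ)) ≤ 1 :=
      Real.exp_le_one_iff.2 (by
        have : 0 ≤ k * (r - l / 2) ^ 2 / σ := by positivity
        linarith)
    have : 0 < M * σ ^ (-α) := by positivity
    nlinarith
  · intro t ht
    refine lt_of_lt_of_le ?_ (u0 t ⟨ht.1.le, ht.2⟩ l ⟨hl.le, le_rfl⟩)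
    unfold bU
    have hs : 0 < t1 + σ - t := by linarith [ht.2]
    apply mul_neg_of_pos_of_neg (by positivity)
    rw [sub_neg, hη]
    apply Real.exp_lt_exp.2
    apply neg_lt_neg
    rw [lt_div_iff₀ hs]
    have := ht.1
    nlinarith
  · intro t ht
    left
    refine ⟨l / 2, ⟨by linarith, by linarith⟩, ?_⟩
    have hs : 0 < t1 + σ - t := by linarith [ht.2]
    unfold bU
    have : 0 < M * (t1 + σ - t) ^ (-α) := by positivity
    apply mul_lt_mul_of_pos_left _ this
    apply sub_lt_sub_right
    apply Real.exp_lt_exp.2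
    have : 0 < k * (0 - l / 2) ^ 2 / (t1 + σ - t) := by
      have : (0 - l / 2) ^ 2 = (l/2) ^ 2 := by ring
      rw [this]
      positivity
    simpa using this
  · intro t ht r hr he hv
    have hs : 0 < t1 + σ - t := by linarith [ht.2]
    have hU0 := u0 t ⟨ht.1.le, ht.2⟩ r ⟨hr.1.le, hr.2.le⟩
    rw [he] at hU0
    set s := t1 + σ - t with hsdef
    set z := k * (r - l / 2) ^ 2 / s with hz
    set E := Real.exp (-z) with hE
    have hE0 : 0 < E := Real.exp_pos _
    have hz0 : 0 ≤ z := by positivity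
    have hMs : 0 < M * s ^ (-α) := by positivity
    have hEη : 0 ≤ E - η := by
      have : bU M α k η (l / 2) (t1 + σ) t r = M * s ^ (-α) * (E - η) := rfl
      rw [this] at hU0
      exact nonneg_of_mul_nonneg_right hU0 hMs
    have hzn : z ≤ n := by
      have : η ≤ E := by linarith
      have := Real.exp_le_exp.1 this
      linarith
    have key := hMz z hz0 hzn
    have hvp : c * (M * s ^ (-β) * (E - η)) ^ p ≤ c * v t r ^ p := by
      have : bU M β k η (l / 2) (t1 + σ) t r = M * s ^ (-β) * (E - η) := rfl
      rw [this] at hv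
      gcongr
    have hsp : (M * s ^ (-β) * (E - η)) ^ p = M * s ^ (-α - 1) * (M ^ (p - 1) * (E - η) ^ p) := by
      rw [Real.mul_rpow (by positivity) hEη, Real.mul_rpow hM.le (by positivity),
        ← Real.rpow_mul hs.le]
      have e1 : -β * p = -α - 1 := by linarith
      have e2 : M ^ p = M * M ^ (p - 1) := by
        rw [Real.rpow_sub hM, Real.rpow_one]; field_simp
      rw [e1, e2]; ring
    have hsa : s ^ (-α) = s ^ (-α - 1) * s := by
      rw [Real.rpow_sub hs, Real.rpow_one]; field_simp
    refine ⟨M * (α * s ^ (-α - 1)) * (E - η) + M * s ^ (-α) * (E * (-(k * (r - l / 2) ^ 2 / s ^ 2))),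
      M * s ^ (-α) * (E * (4 * k ^ 2 * (r - l / 2) ^ 2 / s ^ 2 - 2 * k / s)),
      fun y => M * s ^ (-α) * (Real.exp (-(k * (y - l / 2) ^ 2 / s)) * (-(2 * k / s * (y - l / 2)))),
      ?_, ?_, ?_, ?_⟩
    · have h1 : HasDerivAt (fun x : ℝ => t1 + σ - x) (-1) t := by
        simpa using (hasDerivAt_id t).const_sub (t1 + σ)
      have h2 := (h1.rpow_const (p := -α) (Or.inl hs.ne')).const_mul M
      have h3 := ((((hasDerivAt_const t (k * (r - l / 2) ^ 2)).div h1 hs.ne').neg).exp).sub_const η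
      have := h2.mul h3
      refine this.congr_deriv ?_
      simp only [Pi.neg_apply, Pi.div_apply, ← hsdef, ← hz, ← hE]
      ring
    · intro y
      have := (((((((hasDerivAt_id y).sub_const (l / 2)).pow 2).const_mul k).div_const
        s).neg.exp).sub_const η).const_mul (M * s ^ (-α))
      refine this.congr_deriv ?_
      simp only [id, Nat.cast_ofNat, Pi.neg_apply, Pi.div_apply, Pi.pow_apply]
      ring
    · have h1 := (((((((hasDerivAt_id r).sub_const (l / 2)).pow 2).const_mul k).div_const
        s).neg.exp))
      have h2 := (((hasDerivAt_id r).sub_const (l / 2)).const_mul (2 * k / s)).neg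
      have := (h1.mul h2).const_mul (M * s ^ (-α))
      refine this.congr_deriv ?_
      simp only [id, Nat.cast_ofNat, Pi.neg_apply, Pi.div_apply, Pi.pow_apply, ← hz, ← hE]
      ring
    · have hsh := shift_ge hn hr.1 (show 0 ≤ l / 2 by linarith)
          (show 0 ≤ M * s ^ (-α) * E * (2 * k / s) by positivity)
      refine lt_of_lt_of_le ?_ (add_le_add_right hvp _)
      rw [hsp]
      have e3 : d1 * (M * s ^ (-α) * (E * (4 * k ^ 2 * (r - l / 2) ^ 2 / s ^ 2 - 2 * k / s))
          + -(((n:ℝ) - 1) * (M * s ^ (-α) * E * (2 * k / s)))) =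
          M * s ^ (-α - 1) * (d1 * (E * (4 * k * z - 2 * k * n))) := by
        rw [hsa, hz]; field_simp; ring
      have e4 : M * (α * s ^ (-α - 1)) * (E - η)
          + M * s ^ (-α) * (E * (-(k * (r - l / 2) ^ 2 / s ^ 2))) =
          M * s ^ (-α - 1) * (α * (E - η) - z * E) := by
        rw [hsa, hz]; field_simp; ring
      have e5 : ((n:ℝ) - 1) / r * (M * s ^ (-α) * (Real.exp (-(k * (r - l / 2) ^ 2 / s))
          * (-(2 * k / s * (r - l / 2))))) =
          ((n:ℝ) - 1) / r * (-(M * s ^ (-α) * E * (2 * k / s) * (r - l / 2))) := by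
        rw [hE]; ring
      simp only []
      rw [e4, e5]
      have h6 := mul_le_mul_of_nonneg_left (add_le_add_right hsh
        (M * s ^ (-α) * (E * (4 * k ^ 2 * (r - l / 2) ^ 2 / s ^ 2 - 2 * k / s)))) hd1.le
      rw [e3] at h6
      refine lt_of_lt_of_le ?_ (add_le_add_left h6 _)
      have h7 : 0 < M * s ^ (-α - 1) := by positivity
      have := mul_lt_mul_of_pos_left key h7
      rw [← sub_pos] at this ⊢
      refine lt_of_lt_of_eq this ?_
      ring

theorem KSol.blow {n : ℕ} (hn : 1 ≤ n) {R d1 d2 c p q T : ℝ} {u v : ℝ → ℝ → ℝ}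
    (hd1 : 0 < d1) (hd2 : 0 < d2) (hc : 0 < c) (hp : 1 < p) (hq : 1 < q)
    (S : KSol n R d1 d2 c p q T u v) {t1 σ l k M α β : ℝ} (hα : 0 < α) (hβ : 0 < β)
    (hβp : β * p = α + 1) (hαq : α * q = β + 1) (ht1 : 0 ≤ t1) (hσ : 0 < σ)
    (hT : t1 + σ < T) (hl : 0 < l) (hk : 0 < k) (hlk : k * l ^ 2 = 4 * n * σ) (hlR : l ≤ R)
    (hM : 0 < M)
    (hMz : ∀ z : ℝ, 0 ≤ z → z ≤ n →
      α * (Real.exp (-z) - Real.exp (-n)) - z * Real.exp (-z)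
        - d1 * (Real.exp (-z) * (4 * k * z - 2 * k * n))
        < c * M ^ (p - 1) * (Real.exp (-z) - Real.exp (-n)) ^ p)
    (hMz' : ∀ z : ℝ, 0 ≤ z → z ≤ n →
      β * (Real.exp (-z) - Real.exp (-n)) - z * Real.exp (-z)
        - d2 * (Real.exp (-z) * (4 * k * z - 2 * k * n))
        < c * M ^ (q - 1) * (Real.exp (-z) - Real.exp (-n)) ^ q)
    (hu : ∀ r ∈ Icc 0 l, M * σ ^ (-α) ≤ u t1 r)
    (hv : ∀ r ∈ Icc 0 l, M * σ ^ (-β) ≤ v t1 r) : False := by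
  have hn' : (1:ℝ) ≤ n := by exact_mod_cast hn
  have hη1 : Real.exp (-(n:ℝ)) < 1 := Real.exp_lt_one_iff.2 (by linarith)
  have hlow : ∀ t ∈ Ico t1 (t1 + σ),
      M * (1 - Real.exp (-(n:ℝ))) * (t1 + σ - t) ^ (-α) ≤ u t (l / 2) := by
    intro t ht
    have := (S.compare hd1 hd2 ht1 (b := t) (by linarith [ht.2]) hlR
      (bU_sub hn hd1 hc hp S hα hβp ht1 ht.1 ht.2 hT hl hk hlk hlR hM hMz hu)
      (bU_sub hn hd2 hc hq S.symm hβ hαq ht1 ht.1 ht.2 hT hl hk hlk hlR hM hMz' hv)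
      t ⟨ht.1, le_rfl⟩ (l / 2) ⟨by linarith, by linarith⟩).1.le
    refine le_trans (le_of_eq ?_) this
    simp [bU]; ring
  have hcont : ContinuousOn (fun t => u t (l / 2)) (Icc t1 (t1 + σ)) := by
    have := S.uc.comp (f := fun t : ℝ => ((t, l / 2) : ℝ × ℝ)) (s := Icc t1 (t1 + σ)) (by fun_prop)
      (fun t ht => ⟨⟨ht1.trans ht.1, ht.2.trans_lt hT⟩, ⟨by simp; linarith, by simp; linarith⟩⟩)
    exact this
  obtain ⟨C, hC⟩ := (isCompact_Icc.image_of_continuousOn hcont).bddAbove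
  have hlim : Tendsto (fun s : ℝ => M * (1 - Real.exp (-(n:ℝ))) * s ^ (-α)) (𝓝[>] 0) atTop := by
    apply Tendsto.const_mul_atTop (by apply mul_pos hM; linarith)
    exact tendsto_rpow_neg_nhdsGT_zero (by linarith)
  have h1 := (hlim.eventually (eventually_gt_atTop C)).and (Ioo_mem_nhdsGT hσ)
  obtain ⟨s, hs, hs2⟩ := h1.exists
  have h2 := hlow (t1 + σ - s) ⟨by linarith [hs2.2], by linarith [hs2.1]⟩
  have h3 := hC ⟨t1 + σ - s, ⟨by linarith [hs2.2], by linarith [hs2.1]⟩, rfl⟩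
  have e : t1 + σ - (t1 + σ - s) = s := by ring
  rw [e] at h2
  simp only at h3
  linarith

noncomputable def kG (m d θ h x r : ℝ) : ℝ :=
  (x + θ) ^ (-m) * Real.exp (-((r - h) ^ 2 / (4 * d * (x + θ))))

theorem kG_pos {m d θ h x r : ℝ} (hx : 0 < x + θ) : 0 < kG m d θ h x r := by
  unfold kG; positivity

theorem kG_t {m d θ h a t r : ℝ} (hd : 0 < d) (hx : 0 < t - a + θ) :
    HasDerivAt (fun s => kG m d θ h (s - a) r)
      (kG m d θ h (t - a) r * (-(m / (t - a + θ)) + (r - h) ^ 2 / (4 * d * (t - a + θ) ^ 2))) t := by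
  have h1 : HasDerivAt (fun s : ℝ => s - a + θ) 1 t :=
    ((hasDerivAt_id t).sub_const a).add_const θ
  have h2 := h1.rpow_const (p := -m) (Or.inl hx.ne')
  have h3 := (((hasDerivAt_const t ((r - h) ^ 2)).div (h1.const_mul (4 * d))
    (by positivity)).neg).exp
  refine (h2.mul h3).congr_deriv ?_
  have e : (t - a + θ) ^ (-m - 1) = (t - a + θ) ^ (-m) / (t - a + θ) := by
    rw [Real.rpow_sub hx, Real.rpow_one]
  simp only [Pi.neg_apply, Pi.div_apply, e, kG]
  field_simp
  ring

theorem kG_r {m d θ h x y : ℝ} :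
    HasDerivAt (kG m d θ h x) (kG m d θ h x y * (-(1 / (2 * d * (x + θ)) * (y - h)))) y := by
  have := (((((hasDerivAt_id y).sub_const h).pow 2).div_const
        (4 * d * (x + θ))).neg.exp).const_mul ((x + θ) ^ (-m))
  refine this.congr_deriv ?_
  simp only [id, Nat.cast_ofNat, Pi.neg_apply, Pi.pow_apply, kG]
  generalize x + θ = X
  ring

theorem kG_rr {m d θ h x y : ℝ} :
    HasDerivAt (fun y => kG m d θ h x y * (-(1 / (2 * d * (x + θ)) * (y - h))))
      (kG m d θ h x y * ((y - h) ^ 2 / (4 * d ^ 2 * (x + θ) ^ 2) - 1 / (2 * d * (x + θ)))) y := by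
  have h2 := (((hasDerivAt_id y).sub_const h).const_mul (1 / (2 * d * (x + θ)))).neg
  refine ((kG_r (m := m) (d := d) (θ := θ) (h := h) (x := x) (y := y)).mul h2).congr_deriv ?_
  simp only [id, Pi.neg_apply]
  generalize kG m d θ h x y = g
  generalize x + θ = X
  ring

theorem kG_cont {m d θ h a b D : ℝ} (hd : 0 < d) (hθ : 0 < θ) :
    ContinuousOn (fun z : ℝ × ℝ => kG m d θ h (z.1 - a) z.2) (Icc a b ×ˢ Icc (0:ℝ) D) := by
  have hne : ∀ z ∈ Icc a b ×ˢ Icc 0 D, 0 < z.1 - a + θ := by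
    intro z hz
    have := hz.1.1
    linarith
  unfold kG
  apply ContinuousOn.mul
  · apply ContinuousOn.rpow_const (by fun_prop)
    intro z hz; exact Or.inl (hne z hz).ne'
  · apply Real.continuous_exp.comp_continuousOn
    apply ContinuousOn.neg
    refine ContinuousOn.div (by fun_prop) (by fun_prop) ?_
    intro z hz
    have := hne z hz
    positivity

theorem bdry_est {m X E ω : ℝ} (hm : 1 / 2 ≤ m) (hX : 0 < X) (hω : 0 < ω)
    (hE : 3072 * m * ω ≤ E) : X ^ (-m) * Real.exp (-(E / X)) ≤ (3 * ω) ^ (-m) / 32 := by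
  have hm0 : 0 < m := by linarith
  have hE0 : 0 < E := lt_of_lt_of_le (by positivity) hE
  have h1 : E / X / m ≤ Real.exp (E / X / m) := by
    have := Real.add_one_le_exp (E / X / m); linarith
  have h2 : (E / X / m) ^ m ≤ Real.exp (E / X) := by
    have := Real.rpow_le_rpow (by positivity) h1 hm0.le
    rwa [← Real.exp_mul, div_mul_cancel₀ _ hm0.ne'] at this
  have h3 : Real.exp (-(E / X)) ≤ (E / X / m) ^ (-m) := by
    rw [Real.exp_neg, Real.rpow_neg (by positivity)]
    exact inv_anti₀ (by positivity) h2
  calc X ^ (-m) * Real.exp (-(E / X)) ≤ X ^ (-m) * (E / X / m) ^ (-m) := by gcongr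
    _ = (E / m) ^ (-m) := by
        rw [← Real.mul_rpow hX.le (by positivity)]
        congr 1; field_simp
    _ ≤ (1024 * (3 * ω)) ^ (-m) := by
        apply Real.rpow_le_rpow_of_nonpos (by positivity) _ (by linarith)
        rw [le_div_iff₀ hm0]; linarith
    _ = 1024 ^ (-m) * (3 * ω) ^ (-m) := Real.mul_rpow (by norm_num) (by positivity)
    _ ≤ (1 / 32) * (3 * ω) ^ (-m) := by
        gcongr
        have : (1024:ℝ) ^ (-m) ≤ 1024 ^ (-(1/2) : ℝ) :=
          Real.rpow_le_rpow_of_exponent_le (by norm_num) (by linarith)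
        refine this.trans (le_of_eq ?_)
        rw [show (1024:ℝ) = 32 ^ (2:ℝ) by norm_num, ← Real.rpow_mul (by norm_num)]
        norm_num [Real.rpow_neg_one]
    _ = _ := by ring

set_option maxHeartbeats 1600000 in
theorem KSol.spread {n : ℕ} (hn : 1 ≤ n) {R d1 d2 c p q T : ℝ} {u v : ℝ → ℝ → ℝ}
    (hd1 : 0 < d1) (hd2 : 0 < d2) (hc : 0 < c)
    (S : KSol n R d1 d2 c p q T u v) {a ω ρ θ D K m : ℝ} (ha : 0 ≤ a) (hω : 0 < ω)
    (hm : m = n / 2)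
    (hT : a + 2 * ω < T) (hρ : 0 < ρ) (hD : 0 < D) (hDR : D ≤ R) (hK : 0 < K)
    (hρω : ρ ^ 2 ≤ 16 * d1 * ω) (hDω : 24576 * n * d1 * ω ≤ D ^ 2)
    (hθ : 16 * d1 * (n + 2) * θ = ρ ^ 2)
    (hu : ∀ r ∈ Icc 0 D, r ≤ ρ → K ≤ u a r) :
    ∀ t ∈ Icc (a + ω) (a + 2 * ω), ∀ r ∈ Icc 0 D, r ^ 2 ≤ 2 * d1 * ω →
      K * θ ^ m * ((3 * ω) ^ (-m) / 8) ≤ u t r := by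
  have hn' : (1:ℝ) ≤ n := by exact_mod_cast hn
  have hm2 : 1 / 2 ≤ m := by rw [hm]; linarith
  have hm0 : 0 < m := by linarith
  have hθ0 : 0 < θ := by
    have : 0 < 16 * d1 * (n + 2) * θ := by rw [hθ]; positivity
    exact pos_of_mul_pos_right this (by positivity)
  have hθω : θ ≤ ω := by
    have h1 : 16 * d1 * 1 * θ ≤ 16 * d1 * (n + 2) * θ := by gcongr; linarith
    have h2 : 16 * d1 * θ ≤ 16 * d1 * ω := by linarith
    exact le_of_mul_le_mul_left h2 (by positivity)
  have hhD : ρ / 8 ≤ D / 2 := by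
    have h1 : ρ ^ 2 ≤ D ^ 2 := by
      have : 16 * d1 * ω ≤ 24576 * n * d1 * ω := by
        have : 16 * d1 * ω = (16 * 1) * d1 * ω := by ring
        rw [this]; gcongr; norm_num
      linarith
    have := abs_le_of_sq_le_sq h1 hD.le
    linarith [(le_abs_self ρ).trans this]
  set B := (3 * ω) ^ (-m) / 16 with hB
  have hB0 : 0 < B := by positivity
  set Kc := K * θ ^ m with hKc
  have hKc0 : 0 < Kc := by positivity
  set U : ℝ → ℝ → ℝ := fun t r => Kc * (kG m d1 θ (ρ / 8) (t - a) r
    - 1 / 4 * kG m d1 (2 * θ) 0 (t - a) r - B * (1 + (t - a) / (2 * ω))) with hU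
  set V : ℝ → ℝ → ℝ := fun _ _ => -1 with hV
  have mem : ∀ t ∈ Icc a (a + 2 * ω), t ∈ Ico 0 T := fun t ht =>
    ⟨ha.trans ht.1, ht.2.trans_lt hT⟩
  have mem' : ∀ r ∈ Icc 0 D, r ∈ Icc 0 R := fun r hr => ⟨hr.1, hr.2.trans hDR⟩
  have K2 : KSub n d2 c q a (a + 2 * ω) D v u V U := by
    apply KSub.triv (by linarith) hD.le continuousOn_const
    intro t ht r hr
    have := S.v0 t (mem t ht) r (mem' r hr)
    simp only [hV]; linarith
  have K1 : KSub n d1 c p a (a + 2 * ω) D u v U V := by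
    constructor
    · have h1 := kG_cont (m := m) (h := ρ / 8) (a := a) (b := a + 2 * ω) (D := D) hd1 hθ0
      have h2 := kG_cont (m := m) (h := 0) (a := a) (b := a + 2 * ω) (D := D) hd1
        (show 0 < 2 * θ by linarith)
      have h3 : ContinuousOn (fun z : ℝ × ℝ => B * (1 + (z.1 - a) / (2 * ω)))
        (Icc a (a + 2 * ω) ×ˢ Icc (0:ℝ) D) := by fun_prop
      exact continuousOn_const.mul ((h1.sub (continuousOn_const.mul h2)).sub h3)
    · intro r hr
      simp only [hU, sub_self]
      have hg2 : 0 < kG m d1 (2 * θ) 0 0 r := kG_pos (by linarith)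
      rcases le_or_gt r ρ with h | h
      · refine lt_of_lt_of_le ?_ (hu r hr h)
        have h1 : kG m d1 θ (ρ / 8) 0 r ≤ θ ^ (-m) := by
          unfold kG
          rw [zero_add]
          have : Real.exp (-((r - ρ / 8) ^ 2 / (4 * d1 * θ))) ≤ 1 := Real.exp_le_one_iff.2 (by
            have : 0 ≤ (r - ρ / 8) ^ 2 / (4 * d1 * θ) := by positivity
            linarith)
          have h0 : 0 ≤ θ ^ (-m) := by positivity
          nlinarith
        have e : Kc * θ ^ (-m) = K := by
          rw [hKc, mul_assoc, ← Real.rpow_add hθ0, add_neg_cancel, Real.rpow_zero, mul_one]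
        rw [← e]
        apply mul_lt_mul_of_pos_left _ hKc0
        simp
        linarith
      · refine lt_of_lt_of_le ?_ (S.u0 a (mem a ⟨le_rfl, by linarith⟩) r (mem' r hr))
        apply mul_neg_of_pos_of_neg hKc0
        have h1 : kG m d1 θ (ρ / 8) 0 r ≤ 1 / 4 * kG m d1 (2 * θ) 0 0 r := by
          unfold kG
          simp only [zero_add, sub_zero]
          have s1 : r ^ 2 / (4 * d1 * (2 * θ)) + (n + 2) ≤ (r - ρ / 8) ^ 2 / (4 * d1 * θ) := by
            have e1 : r ^ 2 / (4 * d1 * (2 * θ)) + (n + 2)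
              = (r ^ 2 / 2 + 4 * d1 * (n + 2) * θ) / (4 * d1 * θ) := by field_simp
            rw [e1]
            gcongr
            nlinarith
          have s2 : Real.exp (-((r - ρ / 8) ^ 2 / (4 * d1 * θ))) ≤
              Real.exp (-(r ^ 2 / (4 * d1 * (2 * θ)))) * Real.exp (-(n + 2)) := by
            rw [← Real.exp_add]
            exact Real.exp_le_exp.2 (by linarith)
          have s3 : Real.exp (-((n:ℝ) + 2)) ≤ 1 / 4 * 2 ^ (-m) := by
            have e0 : (2:ℝ) ≤ Real.exp 1 := by
              have := Real.add_one_le_exp (1:ℝ); linarith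
            have e2 : Real.exp (-((n:ℝ) + 2)) = (Real.exp 1) ^ (-((n:ℝ) + 2)) := by
              rw [← Real.exp_mul, one_mul]
            have e3 : (1/4 : ℝ) = 2 ^ (-(2:ℝ)) := by
              rw [Real.rpow_neg (by norm_num)]; norm_num
            rw [e2, e3, ← Real.rpow_add (by norm_num)]
            calc (Real.exp 1) ^ (-((n:ℝ) + 2)) ≤ 2 ^ (-((n:ℝ) + 2)) :=
                  Real.rpow_le_rpow_of_nonpos (by norm_num) e0 (by linarith)
              _ ≤ _ := Real.rpow_le_rpow_of_exponent_le (by norm_num) (by rw [hm]; linarith)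
          rw [Real.mul_rpow (by norm_num) hθ0.le]
          calc θ ^ (-m) * Real.exp (-((r - ρ / 8) ^ 2 / (4 * d1 * θ))) ≤
              θ ^ (-m) * (Real.exp (-(r ^ 2 / (4 * d1 * (2 * θ)))) * (1 / 4 * 2 ^ (-m))) := by
                gcongr
                exact s2.trans (by gcongr)
            _ = _ := by ring
        simp
        linarith
    · intro t ht
      refine lt_of_lt_of_le ?_ (S.u0 t (mem t ⟨ht.1.le, ht.2⟩) D (mem' D ⟨hD.le, le_rfl⟩))
      have htt : 0 < t - a := by linarith [ht.1]
      simp only [hU]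
      apply mul_neg_of_pos_of_neg hKc0
      have hg2 : 0 < kG m d1 (2 * θ) 0 (t - a) D := kG_pos (by linarith)
      have h1 : kG m d1 θ (ρ / 8) (t - a) D ≤ (3 * ω) ^ (-m) / 32 := by
        have := bdry_est (m := m) (X := t - a + θ) (E := (D - ρ / 8) ^ 2 / (4 * d1)) (ω := ω) hm2
          (by linarith) hω (by
            rw [le_div_iff₀ (by positivity), hm]
            nlinarith)
        unfold kG
        rwa [div_div] at this
      have h2 : B * 1 ≤ B * (1 + (t - a) / (2 * ω)) := by
        gcongr
        have : 0 ≤ (t - a) / (2 * ω) := by positivity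
        linarith
      linarith
    · intro t ht
      left
      refine ⟨ρ / 8, ⟨by positivity, by linarith⟩, ?_⟩
      have htt : 0 < t - a := by linarith [ht.1]
      simp only [hU]
      apply mul_lt_mul_of_pos_left _ hKc0
      have g1 : kG m d1 θ (ρ / 8) (t - a) 0 < kG m d1 θ (ρ / 8) (t - a) (ρ / 8) := by
        unfold kG
        apply mul_lt_mul_of_pos_left _ (by positivity)
        apply Real.exp_lt_exp.2
        have : 0 < (0 - ρ / 8) ^ 2 / (4 * d1 * (t - a + θ)) := by
          have : (0 - ρ / 8) ^ 2 = (ρ / 8) ^ 2 := by ring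
          rw [this]; positivity
        simpa using this
      have g2 : kG m d1 (2 * θ) 0 (t - a) (ρ / 8) ≤ kG m d1 (2 * θ) 0 (t - a) 0 := by
        unfold kG
        apply mul_le_mul_of_nonneg_left _ (by positivity)
        apply Real.exp_le_exp.2
        have e : ((0:ℝ) - 0) ^ 2 / (4 * d1 * (t - a + 2 * θ)) = 0 := by simp
        have : 0 ≤ (ρ / 8 - 0) ^ 2 / (4 * d1 * (t - a + 2 * θ)) := by positivity
        rw [e]; linarith
      linarith
    · intro t ht r hr he hv
      have htt : 0 < t - a := by linarith [ht.1]
      have hX : 0 < t - a + θ := by linarith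
      have hY : 0 < t - a + 2 * θ := by linarith
      have hr0 := hr.1
      have gp1 : 0 < kG m d1 θ (ρ / 8) (t - a) r := kG_pos hX
      have T1 := kG_t (m := m) (d := d1) (θ := θ) (h := ρ / 8) (a := a) (t := t) (r := r) hd1 hX
      have T2 := kG_t (m := m) (d := d1) (θ := 2 * θ) (h := 0) (a := a) (t := t) (r := r) hd1 hY
      have T3 : HasDerivAt (fun s : ℝ => B * (1 + (s - a) / (2 * ω))) (B * (1 / (2 * ω))) t :=
        ((((hasDerivAt_id t).sub_const a).div_const (2 * ω)).const_add 1).const_mul B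
      refine ⟨_, _, _, ((T1.sub (T2.const_mul (1 / 4))).sub T3).const_mul Kc,
        fun y => (((kG_r (m := m) (d := d1) (θ := θ) (h := ρ / 8) (x := t - a) (y := y)).sub
          ((kG_r (m := m) (d := d1) (θ := 2 * θ) (h := 0) (x := t - a) (y := y)).const_mul
            (1 / 4))).sub_const (B * (1 + (t - a) / (2 * ω)))).const_mul Kc,
        (((kG_rr (m := m) (d := d1) (θ := θ) (h := ρ / 8) (x := t - a) (y := r)).sub
          ((kG_rr (m := m) (d := d1) (θ := 2 * θ) (h := 0) (x := t - a) (y := r)).const_mul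
            (1 / 4)))).const_mul Kc, ?_⟩
      have hvp : 0 ≤ c * v t r ^ p := by
        have := S.v0 t (mem t ⟨ht.1.le, ht.2⟩) r (mem' r ⟨hr.1.le, hr.2.le⟩)
        positivity
      refine lt_of_lt_of_le ?_ (le_add_of_nonneg_right hvp)
      set g1 := kG m d1 θ (ρ / 8) (t - a) r
      set g2 := kG m d1 (2 * θ) 0 (t - a) r
      set X := t - a + θ
      set Y := t - a + 2 * θ
      have hs := shift_ge hn hr.1 (show 0 ≤ ρ / 8 by positivity)
        (show 0 ≤ g1 * (1 / (2 * d1 * X)) by positivity)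
      have e1 : g1 * (-(m / X) + (r - ρ / 8) ^ 2 / (4 * d1 * X ^ 2)) =
        d1 * (g1 * ((r - ρ / 8) ^ 2 / (4 * d1 ^ 2 * X ^ 2) - 1 / (2 * d1 * X))
          + -(((n:ℝ) - 1) * (g1 * (1 / (2 * d1 * X))))) := by
        rw [hm]; field_simp; ring
      have e2 : g2 * (-(m / Y) + (r - 0) ^ 2 / (4 * d1 * Y ^ 2)) =
        d1 * (g2 * ((r - 0) ^ 2 / (4 * d1 ^ 2 * Y ^ 2) - 1 / (2 * d1 * Y))
          + ((n:ℝ) - 1) / r * (g2 * (-(1 / (2 * d1 * Y) * (r - 0))))) := by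
        rw [hm]; field_simp; ring
      have hs' : g1 * (-(m / X) + (r - ρ / 8) ^ 2 / (4 * d1 * X ^ 2)) ≤
        d1 * (g1 * ((r - ρ / 8) ^ 2 / (4 * d1 ^ 2 * X ^ 2) - 1 / (2 * d1 * X))
          + ((n:ℝ) - 1) / r * (g1 * (-(1 / (2 * d1 * X) * (r - ρ / 8))))) := by
        rw [e1]
        apply mul_le_mul_of_nonneg_left _ hd1.le
        apply add_le_add_right
        refine hs.trans (le_of_eq ?_)
        ring
      have hBp : 0 < B * (1 / (2 * ω)) := by positivity
      have fin : g1 * (-(m / X) + (r - ρ / 8) ^ 2 / (4 * d1 * X ^ 2))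
          - 1 / 4 * (g2 * (-(m / Y) + (r - 0) ^ 2 / (4 * d1 * Y ^ 2))) - B * (1 / (2 * ω)) <
          d1 * (g1 * ((r - ρ / 8) ^ 2 / (4 * d1 ^ 2 * X ^ 2) - 1 / (2 * d1 * X))
          + ((n:ℝ) - 1) / r * (g1 * (-(1 / (2 * d1 * X) * (r - ρ / 8)))))
          - 1 / 4 * (d1 * (g2 * ((r - 0) ^ 2 / (4 * d1 ^ 2 * Y ^ 2) - 1 / (2 * d1 * Y))
          + ((n:ℝ) - 1) / r * (g2 * (-(1 / (2 * d1 * Y) * (r - 0)))))) := by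
        rw [e2]; linarith
      refine lt_of_lt_of_eq (mul_lt_mul_of_pos_left fin hKc0) ?_
      ring
  intro t ht r hr hrl
  have h := (S.compare hd1 hd2 ha hT hDR K1 K2 t ⟨by linarith [ht.1], ht.2⟩ r hr).1
  refine le_trans ?_ h.le
  simp only [hU]
  apply mul_le_mul_of_nonneg_left _ hKc0.le
  have htt : ω ≤ t - a := by linarith [ht.1]
  have htt2 : t - a ≤ 2 * ω := by linarith [ht.2]
  have hX : 0 < t - a + θ := by linarith
  have hY : 0 < t - a + 2 * θ := by linarith
  set Q := (t - a + θ) ^ (-m) with hQ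
  have hQ0 : 0 < Q := by positivity
  have q1 : (3 * ω) ^ (-m) ≤ Q :=
    Real.rpow_le_rpow_of_nonpos hX (by linarith) (by linarith)
  have q2 : kG m d1 (2 * θ) 0 (t - a) r ≤ Q := by
    unfold kG
    have z1 : (t - a + 2 * θ) ^ (-m) ≤ Q :=
      Real.rpow_le_rpow_of_nonpos hX (by linarith) (by linarith)
    have z2 : Real.exp (-((r - 0) ^ 2 / (4 * d1 * (t - a + 2 * θ)))) ≤ 1 :=
      Real.exp_le_one_iff.2 (by
        have : 0 ≤ (r - 0) ^ 2 / (4 * d1 * (t - a + 2 * θ)) := by positivity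
        linarith)
    calc _ ≤ Q * 1 := mul_le_mul z1 z2 (Real.exp_pos _).le hQ0.le
      _ = Q := mul_one Q
  have q3 : Q * (1 / 2) ≤ kG m d1 θ (ρ / 8) (t - a) r := by
    unfold kG
    apply mul_le_mul_of_nonneg_left _ hQ0.le
    have z1 : (r - ρ / 8) ^ 2 / (4 * d1 * (t - a + θ)) ≤ 1 / 2 := by
      rw [div_le_iff₀ (by positivity)]
      have w1 : 2 * d1 * ω ≤ 2 * d1 * (t - a + θ) := by gcongr; linarith
      have w2 : (r - ρ / 8) ^ 2 ≤ 2 * d1 * ω := by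
        have hr0 := hr.1
        rcases le_total r (ρ / 8) with h | h <;> nlinarith
      linarith
    have := Real.add_one_le_exp (-((r - ρ / 8) ^ 2 / (4 * d1 * (t - a + θ))))
    linarith
  have q4 : B * (1 + (t - a) / (2 * ω)) ≤ B * 2 := by
    gcongr
    have : (t - a) / (2 * ω) ≤ 1 := by
      rw [div_le_iff₀ (by positivity)]; linarith
    linarith
  linarith

set_option maxHeartbeats 1000000 in
theorem kaplan_half (n : ℕ) (hn : 1 ≤ n) (R : ℝ) (hR : 0 < R)
    (p q d1 d2 : ℝ) (hp : 1 < p) (hq : 1 < q) (hd1 : 0 < d1) (hd2 : 0 < d2)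
    (c : ℝ) (hc : 0 < c) (T : ℝ) (hT : 0 < T) :
    ∃ M₀ > (0:ℝ), ∀ u v : ℝ → ℝ → ℝ, KSol n R d1 d2 c p q T u v →
      ∀ t ∈ Ico (0:ℝ) T, ∀ ρ : ℝ, 0 < ρ → ρ ≤ R →
        u t ρ ≤ M₀ * ρ ^ (-(n : ℝ)) * (T - t) ^ (-((p + 1) / (p * q - 1))) := by
  have hn' : (1:ℝ) ≤ n := by exact_mod_cast hn
  have hpq : 0 < p * q - 1 := by nlinarith
  set α := (p + 1) / (p * q - 1) with hα
  set β := (q + 1) / (p * q - 1) with hβ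
  have hα0 : 0 < α := by apply div_pos <;> linarith
  have hβ0 : 0 < β := by apply div_pos <;> linarith
  have hne : p * q - 1 ≠ 0 := hpq.ne'
  have hβp : β * p = α + 1 := by
    rw [hα, hβ, div_mul_eq_mul_div, div_add_one hne]; congr 1; ring
  have hαq : α * q = β + 1 := by
    rw [hα, hβ, div_mul_eq_mul_div, div_add_one hne]; congr 1; ring
  set k := 8 * n / d1 with hk
  have hk0 : 0 < k := by positivity
  obtain ⟨Ma, hMa, hMa'⟩ := blow_const hn hd1 hα0 hp hk0 hc
  obtain ⟨Mb, hMb, hMb'⟩ := blow_const hn hd2 hβ0 hq hk0 hc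
  set M := max Ma Mb with hM
  have hM0 : 0 < M := lt_max_of_lt_left hMa
  set G := 1 + 4 * n * d2 / d1 with hG
  have hG0 : 0 < G := by positivity
  set M1 := max M ((4 * G * M / c) ^ (1 / q)) with hM1
  have hM10 : 0 < M1 := lt_max_of_lt_left hM0
  have hM1M : M ≤ M1 := le_max_left _ _
  have hM1q : M ≤ c * M1 ^ q / (4 * G) := by
    have h1 : 4 * G * M / c ≤ M1 ^ q := by
      have h2 : (4 * G * M / c) = ((4 * G * M / c) ^ (1 / q)) ^ q := by
        rw [← Real.rpow_mul (by positivity), one_div_mul_cancel (by linarith), Real.rpow_one]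
      rw [h2]
      exact Real.rpow_le_rpow (by positivity) (le_max_right _ _) (by linarith)
    rw [div_le_iff₀ hc] at h1
    rw [le_div_iff₀ (by positivity)]
    linarith
  set μ := min (1 / 4) (R ^ 2 / (24576 * n * d1 * T)) with hμ
  have hμ0 : 0 < μ := lt_min (by norm_num) (by positivity)
  have hμ4 : μ ≤ 1 / 4 := min_le_left _ _
  have hμR : 24576 * n * d1 * (μ * T) ≤ R ^ 2 := by
    have := min_le_right (1 / 4) (R ^ 2 / (24576 * n * d1 * T))
    rw [← hμ, le_div_iff₀ (by positivity)] at this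
    linarith
  set κ := min (1 / (48 * d1 * (n + 2) * T)) (1 / (3 * (n + 2) * R ^ 2)) with hκ
  have hκ0 : 0 < κ := lt_min (by positivity) (by positivity)
  set m : ℝ := n / 2 with hm
  have hm0 : 0 < m := by positivity
  refine ⟨8 * M1 * μ ^ (-α) * κ ^ (-m), by positivity, ?_⟩
  intro u v S t ht ρ hρ hρR
  have hs : 0 < T - t := by linarith [ht.2]
  set s := T - t with hsd
  set K := u t ρ with hK
  rcases le_or_gt K 0 with hK0 | hK0
  · exact hK0.trans (by positivity)
  set ω := μ * s with hω
  have hω0 : 0 < ω := by positivity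
  have hωT : ω ≤ μ * T := by
    apply mul_le_mul_of_nonneg_left _ hμ0.le
    linarith [ht.1]
  have hωs : ω ≤ s / 4 := by nlinarith
  set ρ' := min ρ (√(16 * d1 * ω)) with hρ'
  have hρ'0 : 0 < ρ' := lt_min hρ (by positivity)
  have hρ'ω : ρ' ^ 2 ≤ 16 * d1 * ω := by
    have := pow_le_pow_left₀ hρ'0.le (min_le_right ρ (√(16 * d1 * ω))) 2
    rwa [Real.sq_sqrt (by positivity)] at this
  set θ := ρ' ^ 2 / (16 * d1 * (n + 2)) with hθ
  have hθ0 : 0 < θ := by positivity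
  have hDω : 24576 * n * d1 * ω ≤ R ^ 2 := by
    refine le_trans ?_ hμR
    gcongr
  have hsp := S.spread hn hd1 hd2 hc ht.1 hω0 hm (by linarith) hρ'0 hR le_rfl hK0 hρ'ω hDω
    (show 16 * d1 * (n + 2) * θ = ρ' ^ 2 by rw [hθ]; field_simp)
    (fun r hr hrρ => S.ua t ht hr ⟨hρ.le, hρR⟩ (hrρ.trans (min_le_left _ _)))
  set K' := K * θ ^ m * ((3 * ω) ^ (-m) / 8) with hK'
  have hK'0 : 0 < K' := by positivity
  set l := √(d1 * ω / 2) with hl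
  have hl0 : 0 < l := by positivity
  have hl2 : l ^ 2 = d1 * ω / 2 := Real.sq_sqrt (by positivity)
  have hlR : 2 * l ≤ R := by
    refine (le_abs_self _).trans (abs_le_of_sq_le_sq ?_ hR.le)
    have : 2 * d1 * ω ≤ 24576 * n * d1 * ω := by
      have : 2 * d1 * ω = (2 * 1) * d1 * ω := by ring
      rw [this]; gcongr; norm_num
    nlinarith
  have hul : ∀ t' ∈ Icc (t + ω) (t + 2 * ω), ∀ r ∈ Icc 0 (2 * l), K' ≤ u t' r := by
    intro t' ht' r hr
    apply hsp t' ht' r ⟨hr.1, hr.2.trans hlR⟩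
    have := pow_le_pow_left₀ hr.1 hr.2 2
    nlinarith
  have e2 : t + ω + ω = t + 2 * ω := by ring
  have hgr := S.grow hn hd1 hd2 hc (by linarith) (t1 := t + ω) (ω := ω) (l := l) (K := K')
    (P := c * K' ^ q / (2 * G)) (by linarith [ht.1]) hω0 (by linarith) hl0 hlR hK'0 (by positivity)
    (by rw [e2]; exact hul) (by
      have : 1 + 2 * n * d2 * ω / l ^ 2 = G := by
        rw [hl2, hG]; field_simp; ring
      rw [this]
      have e : c * K' ^ q / (2 * G) * G = c * K' ^ q / 2 := by field_simp
      rw [e]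
      have : 0 < c * K' ^ q := by positivity
      linarith)
  rw [e2] at hgr
  have hK'lt : K' < M1 * ω ^ (-α) := by
    by_contra hcon
    push Not at hcon
    refine S.blow hn hd1 hd2 hc hp hq (t1 := t + 2 * ω) (σ := ω) (l := l) (k := k) (M := M)
      hα0 hβ0 hβp hαq (by linarith [ht.1]) hω0 (by linarith) hl0 hk0
      (by rw [hl2, hk]; field_simp; ring) (by linarith) hM0
      (hMa' M (le_max_left _ _)) (hMb' M (le_max_right _ _)) ?_ ?_
    · intro r hr
      refine le_trans ?_ (hul _ ⟨by linarith, le_rfl⟩ r ⟨hr.1, by linarith [hr.2]⟩)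
      refine le_trans ?_ hcon
      gcongr
    · intro r hr
      refine le_trans ?_ (hgr r hr)
      have h1 : (M1 * ω ^ (-α)) ^ q ≤ K' ^ q :=
        Real.rpow_le_rpow (by positivity) hcon (by linarith)
      have h2 : (M1 * ω ^ (-α)) ^ q = M1 ^ q * (ω ^ (-β) / ω) := by
        rw [Real.mul_rpow hM10.le (by positivity), ← Real.rpow_mul hω0.le,
          show -α * q = -β - 1 by linarith, Real.rpow_sub hω0, Real.rpow_one]
      rw [h2] at h1
      calc M * ω ^ (-β) ≤ c * M1 ^ q / (4 * G) * ω ^ (-β) := by gcongr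
        _ = c * (M1 ^ q * (ω ^ (-β) / ω)) / (2 * G) * ω / 2 := by field_simp; ring
        _ ≤ _ := by gcongr
  have hκρ : κ * ρ ^ 2 ≤ θ / (3 * ω) := by
    rcases min_choice ρ (√(16 * d1 * ω)) with h | h
    · rw [← hρ'] at h
      calc κ * ρ ^ 2 ≤ 1 / (48 * d1 * (n + 2) * T) * ρ ^ 2 := by
            gcongr; exact min_le_left _ _
        _ ≤ 1 / (48 * d1 * (n + 2) * ω) * ρ ^ 2 := by
            gcongr
            nlinarith
        _ = _ := by rw [hθ, h]; field_simp; ring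
    · rw [← hρ'] at h
      calc κ * ρ ^ 2 ≤ 1 / (3 * (n + 2) * R ^ 2) * R ^ 2 := by
            gcongr; exact min_le_right _ _
        _ = _ := by
            rw [hθ, h, Real.sq_sqrt (by positivity)]; field_simp
  have hpow : κ ^ m * ρ ^ (n:ℝ) ≤ θ ^ m * (3 * ω) ^ (-m) := by
    have := Real.rpow_le_rpow (by positivity) hκρ hm0.le
    rw [Real.mul_rpow hκ0.le (by positivity), Real.div_rpow hθ0.le (by positivity)] at this
    rw [Real.rpow_neg (by positivity), ← div_eq_mul_inv]
    refine le_trans (le_of_eq ?_) this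
    congr 1
    rw [← Real.rpow_natCast ρ 2, ← Real.rpow_mul hρ.le]
    congr 1
    rw [hm]; push_cast; ring
  have hfin : K * (κ ^ m * ρ ^ (n:ℝ)) ≤ 8 * M1 * (μ ^ (-α) * s ^ (-α)) := by
    rw [← Real.mul_rpow hμ0.le hs.le, ← hω]
    have h1 : K * (κ ^ m * ρ ^ (n:ℝ)) ≤ K * (θ ^ m * (3 * ω) ^ (-m)) := by gcongr
    have h2 : K * (θ ^ m * (3 * ω) ^ (-m)) = 8 * K' := by rw [hK']; ring
    linarith
  have hpos : 0 < κ ^ m * ρ ^ (n:ℝ) := by positivity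
  rw [← le_div_iff₀ hpos] at hfin
  refine hfin.trans (le_of_eq ?_)
  rw [Real.rpow_neg hκ0.le, Real.rpow_neg hρ.le]
  field_simp

theorem kaplan_upper_type_I_estimate
    (n : ℕ) (hn : 1 ≤ n) (R : ℝ) (hR : 0 < R)
    (p q δ : ℝ) (hp : 1 < p) (hq : 1 < q) (hδ : 0 < δ)
    (c₁ : ℝ) (hc₁ : 0 < c₁)
    (T : ℝ) (hT : 0 < T) :
    ∃ M₀ > (0:ℝ), ∀ F G u v : ℝ → ℝ → ℝ,
      ContDiff ℝ 1 (Function.uncurry F) →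
      ContDiff ℝ 1 (Function.uncurry G) →
      (∀ a b : ℝ, 0 ≤ a → 0 ≤ b → 0 ≤ deriv (fun y => F a y) b) →
      (∀ a b : ℝ, 0 ≤ a → 0 ≤ b → 0 ≤ deriv (fun x => G x b) a) →
      (∀ a b : ℝ, 0 ≤ a → 0 ≤ b → c₁ * b ^ p ≤ F a b) →
      (∀ a b : ℝ, 0 ≤ a → 0 ≤ b → c₁ * a ^ q ≤ G a b) →
      (∀ t ∈ Ico (0:ℝ) T, ∀ ρ ∈ Icc (0:ℝ) R, 0 ≤ u t ρ) →
      (∀ t ∈ Ico (0:ℝ) T, ∀ ρ ∈ Icc (0:ℝ) R, 0 ≤ v t ρ) →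
      ContinuousOn (Function.uncurry u) (Ico (0:ℝ) T ×ˢ Icc (0:ℝ) R) →
      ContinuousOn (Function.uncurry v) (Ico (0:ℝ) T ×ˢ Icc (0:ℝ) R) →
      (∀ t ∈ Ioo (0:ℝ) T, ContDiffOn ℝ 2 (u t) (Ioo (0:ℝ) R)) →
      (∀ t ∈ Ioo (0:ℝ) T, ContDiffOn ℝ 2 (v t) (Ioo (0:ℝ) R)) →
      (∀ ρ ∈ Ioo (0:ℝ) R, ∀ t ∈ Ioo (0:ℝ) T, DifferentiableAt ℝ (fun s => u s ρ) t) →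
      (∀ ρ ∈ Ioo (0:ℝ) R, ∀ t ∈ Ioo (0:ℝ) T, DifferentiableAt ℝ (fun s => v s ρ) t) →
      (∀ t ∈ Ioo (0:ℝ) T, u t R = 0) →
      (∀ t ∈ Ioo (0:ℝ) T, v t R = 0) →
      (∀ t ∈ Ico (0:ℝ) T, AntitoneOn (u t) (Icc (0:ℝ) R)) →
      (∀ t ∈ Ico (0:ℝ) T, AntitoneOn (v t) (Icc (0:ℝ) R)) →
      (∀ t ∈ Ioo (0:ℝ) T, ∀ ρ ∈ Ioo (0:ℝ) R,
        deriv (fun s => u s ρ) t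
          = δ * (deriv (deriv (u t)) ρ + ((n : ℝ) - 1) / ρ * deriv (u t) ρ)
            + F (u t ρ) (v t ρ)) →
      (∀ t ∈ Ioo (0:ℝ) T, ∀ ρ ∈ Ioo (0:ℝ) R,
        deriv (fun s => v s ρ) t
          = deriv (deriv (v t)) ρ + ((n : ℝ) - 1) / ρ * deriv (v t) ρ
            + G (u t ρ) (v t ρ)) →
      ∀ t ∈ Ico (0:ℝ) T, ∀ ρ : ℝ, 0 < ρ → ρ ≤ R →
        u t ρ ≤ M₀ * ρ ^ (-(n : ℝ)) * (T - t) ^ (-((p + 1) / (p * q - 1))) ∧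
        v t ρ ≤ M₀ * ρ ^ (-(n : ℝ)) * (T - t) ^ (-((q + 1) / (p * q - 1))) := by
  obtain ⟨Ma, hMa, hA⟩ := kaplan_half n hn R hR p q δ 1 hp hq hδ one_pos c₁ hc₁ T hT
  obtain ⟨Mb, hMb, hB⟩ := kaplan_half n hn R hR q p 1 δ hq hp one_pos hδ c₁ hc₁ T hT
  refine ⟨max Ma Mb, lt_max_of_lt_left hMa, ?_⟩
  intro F G u v _ _ _ _ hF hG hu hv huc hvc hu2 hv2 hut hvt _ _ hua hva hue hve t ht ρ hρ hρR
  have S : KSol n R δ 1 c₁ p q T u v := by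
    refine ⟨hu, hv, huc, hvc, hu2, hv2, hut, hvt, hua, hva, ?_, ?_⟩
    · intro t ht r hr
      have ht' : t ∈ Ico 0 T := ⟨ht.1.le, ht.2⟩
      have hr' : r ∈ Icc 0 R := ⟨hr.1.le, hr.2.le⟩
      rw [hue t ht r hr]
      linarith [hF _ _ (hu t ht' r hr') (hv t ht' r hr')]
    · intro t ht r hr
      have ht' : t ∈ Ico 0 T := ⟨ht.1.le, ht.2⟩
      have hr' : r ∈ Icc 0 R := ⟨hr.1.le, hr.2.le⟩
      rw [hve t ht r hr]
      linarith [hG _ _ (hu t ht' r hr') (hv t ht' r hr')]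
  have hs : 0 < T - t := by linarith [ht.2]
  constructor
  · refine (hA u v S t ht ρ hρ hρR).trans ?_
    gcongr
    exact le_max_left _ _
  · have h := hB v u S.symm t ht ρ hρ hρR
    rw [mul_comm q p] at h
    refine h.trans ?_
    gcongr
    exact le_max_right _ _
end

section
/- Non-degeneracy criterion for blow-up points: let 0 < d₁ < d₀ < R. There exist η, τ₀ > 0, depending only on p, q, r, s, δ, c₁, c₂, d₀, d₁, n, R, T* (in particular independent of the solution), such that for every solution (u,v) as in the context: if for some t₁ ∈ [T*−τ₀, T*) one has (T*−t₁)^α u(t₁,d₁) ≤ η and (T*−t₁)^β v(t₁,d₁) ≤ η (values at radius d₁), then d₀ is not a blow-up point, i.e. there exist ε, C > 0 such that u(t,x) + v(t,x) ≤ C for all (t,x) with T*−ε < t < T* and | |x| − d₀ | < ε. -/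
open Set Filter
open scoped Topology


lemma second_deriv_min (f g g' : ℝ → ℝ) (g'' x : ℝ) (hf : ContDiffAt ℝ 2 f x)
    (hg : ∀ᶠ y in 𝓝 x, HasDerivAt g (g' y) y) (hg2 : HasDerivAt g' g'' x)
    (hmin : ∀ᶠ y in 𝓝 x, g y ≤ f y) (heq : f x = g x) :
    deriv f x = g' x ∧ g'' ≤ deriv (deriv f) x := by
  have hfd : ∀ᶠ y in 𝓝 x, DifferentiableAt ℝ f y := by
    have := hf.eventually (by simp)
    filter_upwards [this] with y hy using hy.differentiableAt (by simp)
  have hfd2 : DifferentiableAt ℝ (deriv f) x := by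
    have h1 : ContDiffAt ℝ 1 (deriv f) x := by
      have h2 := (hf.fderiv_right (m := 1) (by norm_num)).clm_apply
        (contDiffAt_const (c := (1:ℝ)))
      exact h2.congr_of_eventuallyEq (Eventually.of_forall fun y => by simp)
    exact h1.differentiableAt (by simp)
  set w : ℝ → ℝ := fun y => f y - g y with hw
  have hwd : ∀ᶠ y in 𝓝 x, HasDerivAt w (deriv f y - g' y) y := by
    filter_upwards [hfd, hg] with y h1 h2 using h1.hasDerivAt.sub h2
  have hmin' : IsLocalMin w x := by
    filter_upwards [hmin] with y hy
    simp only [hw, heq, sub_self]; linarith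
  have h0 : deriv w x = 0 := hmin'.deriv_eq_zero
  have h1 : deriv w x = deriv f x - g' x := hwd.self_of_nhds.deriv
  have hdw : deriv w =ᶠ[𝓝 x] fun y => deriv f y - g' y := by
    filter_upwards [hwd] with y hy using hy.deriv
  have h2 : deriv (deriv w) x = deriv (deriv f) x - g'' := by
    rw [hdw.deriv_eq]
    exact (hfd2.hasDerivAt.sub hg2).deriv
  refine ⟨by linarith, ?_⟩
  by_contra hlt
  push Not at hlt
  have hneg : deriv (deriv w) x < 0 := by linarith
  have hmax : IsLocalMax w x :=
    isLocalMax_of_deriv_deriv_neg hneg h0 hwd.self_of_nhds.continuousAt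
  have hc : w =ᶠ[𝓝 x] fun _ => w x := by
    filter_upwards [hmin', hmax] with y a b using le_antisymm b a
  have : deriv w =ᶠ[𝓝 x] fun _ => 0 := by
    have := hc.deriv
    filter_upwards [this] with y hy; simp [hy]
  have : deriv (deriv w) x = 0 := by rw [this.deriv_eq]; simp
  linarith

lemma time_deriv (h : ℝ → ℝ) (h' t : ℝ) (hd : HasDerivAt h h' t) (h0 : h t = 0)
    (hl : ∀ᶠ s in 𝓝[<] t, 0 ≤ h s) : h' ≤ 0 := by
  have := hasDerivAt_iff_tendsto_slope.1 hd
  have h2 : Tendsto (slope h t) (𝓝[<] t) (𝓝 h') :=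
    this.mono_left (nhdsWithin_mono _ (fun s hs => ne_of_lt hs))
  refine le_of_tendsto h2 ?_
  filter_upwards [hl, self_mem_nhdsWithin] with s hs hst
  rw [slope_def_field, h0]
  exact div_nonpos_of_nonneg_of_nonpos (by linarith) (by simp only [mem_Iio] at hst; linarith)

/-- `U` is a strict subsolution w.r.t. `u` at the point. -/
def SubB (D k : ℝ) (u U : ℝ → ℝ → ℝ) (t ρ : ℝ) : Prop :=
  ContDiffAt ℝ 2 (u t) ρ ∧ DifferentiableAt ℝ (fun s => u s ρ) t ∧
  ∃ (Ut Urr : ℝ) (Ur : ℝ → ℝ), HasDerivAt (fun s => U s ρ) Ut t ∧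
    (∀ᶠ y in 𝓝 ρ, HasDerivAt (U t) (Ur y) y) ∧ HasDerivAt Ur Urr ρ ∧
    Ut - D * (Urr + k / ρ * Ur ρ) < deriv (fun s => u s ρ) t
      - D * (deriv (deriv (u t)) ρ + k / ρ * deriv (u t) ρ)

def SupB (D k : ℝ) (u U : ℝ → ℝ → ℝ) (t ρ : ℝ) : Prop :=
  ContDiffAt ℝ 2 (u t) ρ ∧ DifferentiableAt ℝ (fun s => u s ρ) t ∧
  ∃ (Ut Urr : ℝ) (Ur : ℝ → ℝ), HasDerivAt (fun s => U s ρ) Ut t ∧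
    (∀ᶠ y in 𝓝 ρ, HasDerivAt (U t) (Ur y) y) ∧ HasDerivAt Ur Urr ρ ∧
    deriv (fun s => u s ρ) t - D * (deriv (deriv (u t)) ρ + k / ρ * deriv (u t) ρ)
      < Ut - D * (Urr + k / ρ * Ur ρ)

lemma SupB.neg {D k : ℝ} {u U : ℝ → ℝ → ℝ} {t ρ : ℝ} (h : SupB D k u U t ρ) :
    SubB D k (fun t x => - u t x) (fun t x => - U t x) t ρ := by
  obtain ⟨h1, h2, Ut, Urr, Ur, h3, h4, h5, h6⟩ := h
  refine ⟨h1.neg, h2.neg, -Ut, -Urr, fun y => - Ur y, h3.neg, ?_, h5.neg, ?_⟩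
  · filter_upwards [h4] with y hy using hy.neg
  · have e1 : deriv (fun s => - u s ρ) t = - deriv (fun s => u s ρ) t := by simp
    have e2 : deriv (fun x => - u t x) = fun x => - deriv (u t) x := by
      ext x; simp
    have e3 : deriv (fun x => - deriv (u t) x) ρ = - deriv (deriv (u t)) ρ := by simp
    rw [e1, e2, e3]
    linarith

lemma touch_false {D k t0 t a b ρ : ℝ} {u U : ℝ → ℝ → ℝ} (hD : 0 < D) (ht : t0 < t)
    (hρ : ρ ∈ Ioo a b) (h : SubB D k u U t ρ) (heq : u t ρ = U t ρ)
    (hge : ∀ s ∈ Icc t0 t, ∀ x ∈ Icc a b, U s x ≤ u s x) : False := by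
  obtain ⟨h1, h2, Ut, Urr, Ur, h3, h4, h5, h6⟩ := h
  obtain ⟨e1, e2⟩ := second_deriv_min (u t) (U t) Ur Urr ρ h1 h4 h5
    (by
      filter_upwards [Ioo_mem_nhds hρ.1 hρ.2] with y hy
      exact hge t ⟨ht.le, le_rfl⟩ y ⟨hy.1.le, hy.2.le⟩) heq
  have e3 := time_deriv (fun s => u s ρ - U s ρ) _ t (h2.hasDerivAt.sub h3) (by simp [heq])
    (by
      filter_upwards [Ioo_mem_nhdsLT ht] with s hs
      have := hge s ⟨hs.1.le, hs.2.le⟩ ρ ⟨hρ.1.le, hρ.2.le⟩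
      linarith)
  rw [e1] at h6
  have := mul_le_mul_of_nonneg_left e2 hD.le
  linarith

lemma abstract_compare (t0 t2 a b : ℝ) (w1 w2 : ℝ → ℝ → ℝ)
    (h1 : ContinuousOn (Function.uncurry w1) (Icc t0 t2 ×ˢ Icc a b))
    (h2 : ContinuousOn (Function.uncurry w2) (Icc t0 t2 ×ˢ Icc a b))
    (hi1 : ∀ x ∈ Icc a b, 0 < w1 t0 x) (hi2 : ∀ x ∈ Icc a b, 0 < w2 t0 x)
    (hs : ∀ t ∈ Ioc t0 t2, ∀ x ∈ Icc a b,
      (∀ s ∈ Icc t0 t, ∀ y ∈ Icc a b, 0 ≤ w1 s y ∧ 0 ≤ w2 s y) → w1 t x ≠ 0 ∧ w2 t x ≠ 0) :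
    ∀ t ∈ Icc t0 t2, ∀ x ∈ Icc a b, 0 < w1 t x ∧ 0 < w2 t x := by
  by_contra hcon
  push Not at hcon
  obtain ⟨t, ht, x, hx, hcon⟩ := hcon
  set W : ℝ × ℝ → ℝ := fun z => min (w1 z.1 z.2) (w2 z.1 z.2) with hW
  have hWc : ContinuousOn W (Icc t0 t2 ×ˢ Icc a b) :=
    continuous_min.comp_continuousOn (h1.prodMk h2)
  set K := (Icc t0 t2 ×ˢ Icc a b) ∩ W ⁻¹' Iic 0 with hK
  have hKc : IsCompact K := by
    refine (isCompact_Icc.prod isCompact_Icc).of_isClosed_subset ?_ inter_subset_left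
    exact hWc.preimage_isClosed_of_isClosed (isClosed_Icc.prod isClosed_Icc) isClosed_Iic
  have hKne : K.Nonempty := by
    refine ⟨(t, x), ⟨ht, hx⟩, ?_⟩
    simp only [hW, mem_preimage, mem_Iic, min_le_iff]
    by_cases h : 0 < w1 t x
    · exact Or.inr (hcon h)
    · exact Or.inl (not_lt.1 h)
  obtain ⟨⟨τ, ξ⟩, hz, hzmin⟩ := hKc.exists_isMinOn hKne continuous_fst.continuousOn
  have hz1 : τ ∈ Icc t0 t2 := hz.1.1
  have hz2 : ξ ∈ Icc a b := hz.1.2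
  have hz3 : W (τ, ξ) ≤ 0 := hz.2
  have hτ : t0 < τ := by
    rcases eq_or_lt_of_le hz1.1 with h | h
    · exfalso
      have := lt_min (hi1 ξ hz2) (hi2 ξ hz2)
      rw [h] at this
      exact absurd hz3 (not_le.2 this)
    · exact h
  have hlt : ∀ s ∈ Ico t0 τ, ∀ y ∈ Icc a b, 0 < W (s, y) := by
    intro s hs' y hy
    by_contra hle
    have : (s, y) ∈ K := ⟨⟨⟨hs'.1, hs'.2.le.trans hz1.2⟩, hy⟩, not_lt.1 hle⟩
    have := hzmin this
    simp only [mem_ofPred_eq] at this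
    exact absurd hs'.2 (not_lt.2 this)
  have hle : ∀ s ∈ Icc t0 τ, ∀ y ∈ Icc a b, 0 ≤ W (s, y) := by
    intro s hs' y hy
    rcases eq_or_lt_of_le hs'.2 with h | h
    · have hc : ContinuousOn (fun s => W (s, y)) (Icc t0 t2) := by
        refine hWc.comp (by fun_prop) ?_
        intro r hr; exact ⟨hr, hy⟩
      have hc2 : Tendsto (fun s => W (s, y)) (𝓝[Ico t0 τ] τ) (𝓝 (W (τ, y))) :=
        (hc τ hz1).mono_left (nhdsWithin_mono _ (fun r hr => ⟨hr.1, hr.2.le.trans hz1.2⟩))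
      rw [h]
      have : (𝓝[Ico t0 τ] τ).NeBot := by
        rw [← mem_closure_iff_nhdsWithin_neBot, closure_Ico hτ.ne]
        exact ⟨hτ.le, le_rfl⟩
      refine ge_of_tendsto hc2 ?_
      filter_upwards [self_mem_nhdsWithin] with r hr using (hlt r hr y hy).le
    · exact (hlt s ⟨hs'.1, h⟩ y hy).le
  have h0 : W (τ, ξ) = 0 := le_antisymm hz3 (hle τ ⟨hτ.le, le_rfl⟩ ξ hz2)
  have := hs τ ⟨hτ, hz1.2⟩ ξ hz2 (fun s hs' y hy => le_min_iff.1 (hle s hs' y hy))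
  rcases min_choice (w1 τ ξ) (w2 τ ξ) with h | h
  · exact this.1 (h.symm.trans h0)
  · exact this.2 (h.symm.trans h0)

lemma compare_sub {D1 D2 k t0 t2 a b : ℝ} (u v U V : ℝ → ℝ → ℝ) (hD1 : 0 < D1) (hD2 : 0 < D2)
    (hu : ContinuousOn (Function.uncurry u) (Icc t0 t2 ×ˢ Icc a b))
    (hv : ContinuousOn (Function.uncurry v) (Icc t0 t2 ×ˢ Icc a b))
    (hU : ContinuousOn (Function.uncurry U) (Icc t0 t2 ×ˢ Icc a b))
    (hV : ContinuousOn (Function.uncurry V) (Icc t0 t2 ×ˢ Icc a b))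
    (hi1 : ∀ x ∈ Icc a b, U t0 x < u t0 x) (hi2 : ∀ x ∈ Icc a b, V t0 x < v t0 x)
    (hs1 : ∀ t ∈ Ioc t0 t2, ∀ x ∈ Icc a b, u t x = U t x → V t x ≤ v t x →
      x ∈ Ioo a b ∧ SubB D1 k u U t x)
    (hs2 : ∀ t ∈ Ioc t0 t2, ∀ x ∈ Icc a b, v t x = V t x → U t x ≤ u t x →
      x ∈ Ioo a b ∧ SubB D2 k v V t x) :
    ∀ t ∈ Icc t0 t2, ∀ x ∈ Icc a b, U t x < u t x ∧ V t x < v t x := by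
  have := abstract_compare t0 t2 a b (fun t x => u t x - U t x) (fun t x => v t x - V t x)
    (hu.sub hU) (hv.sub hV) (fun x hx => sub_pos.2 (hi1 x hx)) (fun x hx => sub_pos.2 (hi2 x hx))
    (by
      intro t ht x hx hpast
      have hp := hpast t ⟨ht.1.le, le_rfl⟩ x hx
      constructor
      · intro h0
        obtain ⟨h1, h2⟩ := hs1 t ht x hx (sub_eq_zero.1 h0) (sub_nonneg.1 hp.2)
        exact touch_false hD1 ht.1 h1 h2 (sub_eq_zero.1 h0)
          (fun s hs y hy => sub_nonneg.1 (hpast s hs y hy).1)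
      · intro h0
        obtain ⟨h1, h2⟩ := hs2 t ht x hx (sub_eq_zero.1 h0) (sub_nonneg.1 hp.1)
        exact touch_false hD2 ht.1 h1 h2 (sub_eq_zero.1 h0)
          (fun s hs y hy => sub_nonneg.1 (hpast s hs y hy).2))
  intro t ht x hx
  exact ⟨sub_pos.1 (this t ht x hx).1, sub_pos.1 (this t ht x hx).2⟩

lemma compare_sup {D1 D2 k t0 t2 a b : ℝ} (u v U V : ℝ → ℝ → ℝ) (hD1 : 0 < D1) (hD2 : 0 < D2)
    (hu : ContinuousOn (Function.uncurry u) (Icc t0 t2 ×ˢ Icc a b))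
    (hv : ContinuousOn (Function.uncurry v) (Icc t0 t2 ×ˢ Icc a b))
    (hU : ContinuousOn (Function.uncurry U) (Icc t0 t2 ×ˢ Icc a b))
    (hV : ContinuousOn (Function.uncurry V) (Icc t0 t2 ×ˢ Icc a b))
    (hi1 : ∀ x ∈ Icc a b, u t0 x < U t0 x) (hi2 : ∀ x ∈ Icc a b, v t0 x < V t0 x)
    (hs1 : ∀ t ∈ Ioc t0 t2, ∀ x ∈ Icc a b, u t x = U t x → v t x ≤ V t x →
      x ∈ Ioo a b ∧ SupB D1 k u U t x)
    (hs2 : ∀ t ∈ Ioc t0 t2, ∀ x ∈ Icc a b, v t x = V t x → u t x ≤ U t x →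
      x ∈ Ioo a b ∧ SupB D2 k v V t x) :
    ∀ t ∈ Icc t0 t2, ∀ x ∈ Icc a b, u t x < U t x ∧ v t x < V t x := by
  have := compare_sub (k := k) (fun t x => - u t x) (fun t x => - v t x) (fun t x => - U t x)
    (fun t x => - V t x) hD1 hD2 hu.neg hv.neg hU.neg hV.neg
    (fun x hx => neg_lt_neg (hi1 x hx)) (fun x hx => neg_lt_neg (hi2 x hx))
    (fun t ht x hx h1 h2 => by
      obtain ⟨a1, a2⟩ := hs1 t ht x hx (neg_injective h1) (neg_le_neg_iff.1 h2)
      exact ⟨a1, a2.neg⟩)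
    (fun t ht x hx h1 h2 => by
      obtain ⟨a1, a2⟩ := hs2 t ht x hx (neg_injective h1) (neg_le_neg_iff.1 h2)
      exact ⟨a1, a2.neg⟩)
  intro t ht x hx
  exact ⟨neg_lt_neg_iff.1 (this t ht x hx).1, neg_lt_neg_iff.1 (this t ht x hx).2⟩

/-- one component of the system -/
structure Sol (D k R T : ℝ) (u f : ℝ → ℝ → ℝ) : Prop where
  nn : ∀ t ∈ Ico (0:ℝ) T, ∀ ρ ∈ Icc (0:ℝ) R, 0 ≤ u t ρ
  cont : ContinuousOn (Function.uncurry u) (Ico (0:ℝ) T ×ˢ Icc (0:ℝ) R)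
  c2 : ∀ t ∈ Ioo (0:ℝ) T, ContDiffOn ℝ 2 (u t) (Ioo (0:ℝ) R)
  dt : ∀ ρ ∈ Ioo (0:ℝ) R, ∀ t ∈ Ioo (0:ℝ) T, DifferentiableAt ℝ (fun s => u s ρ) t
  anti : ∀ t ∈ Ico (0:ℝ) T, AntitoneOn (u t) (Icc (0:ℝ) R)
  pde : ∀ t ∈ Ioo (0:ℝ) T, ∀ ρ ∈ Ioo (0:ℝ) R,
        deriv (fun s => u s ρ) t
          = D * (deriv (deriv (u t)) ρ + k / ρ * deriv (u t) ρ) + f t ρ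

lemma Sol.sub {D k R T : ℝ} {u f U : ℝ → ℝ → ℝ} (h : Sol D k R T u f) {t ρ : ℝ}
    (ht : t ∈ Ioo 0 T) (hρ : ρ ∈ Ioo 0 R) {Ut Urr : ℝ} {Ur : ℝ → ℝ}
    (h1 : HasDerivAt (fun s => U s ρ) Ut t)
    (h2 : ∀ᶠ y in 𝓝 ρ, HasDerivAt (U t) (Ur y) y) (h3 : HasDerivAt Ur Urr ρ)
    (h4 : Ut - D * (Urr + k / ρ * Ur ρ) < f t ρ) : SubB D k u U t ρ := by
  refine ⟨(h.c2 t ht).contDiffAt (Ioo_mem_nhds hρ.1 hρ.2), h.dt ρ hρ t ht, Ut, Urr, Ur, h1, h2,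
    h3, ?_⟩
  rw [h.pde t ht ρ hρ]; linarith

lemma Sol.sup {D k R T : ℝ} {u f U : ℝ → ℝ → ℝ} (h : Sol D k R T u f) {t ρ : ℝ}
    (ht : t ∈ Ioo 0 T) (hρ : ρ ∈ Ioo 0 R) {Ut Urr : ℝ} {Ur : ℝ → ℝ}
    (h1 : HasDerivAt (fun s => U s ρ) Ut t)
    (h2 : ∀ᶠ y in 𝓝 ρ, HasDerivAt (U t) (Ur y) y) (h3 : HasDerivAt Ur Urr ρ)
    (h4 : f t ρ < Ut - D * (Urr + k / ρ * Ur ρ)) : SupB D k u U t ρ := by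
  refine ⟨(h.c2 t ht).contDiffAt (Ioo_mem_nhds hρ.1 hρ.2), h.dt ρ hρ t ht, Ut, Urr, Ur, h1, h2,
    h3, ?_⟩
  rw [h.pde t ht ρ hρ]; linarith

/-- derivatives of `c (S - t + e (ρ-m)^2)^(-α)` -/
lemma theta_derivs (c S e m α t ρ : ℝ) (hpos : 0 < S - t + e * (ρ - m) ^ 2) :
    HasDerivAt (fun s => c * (S - s + e * (ρ - m) ^ 2) ^ (-α))
      (α * c * (S - t + e * (ρ - m) ^ 2) ^ (-α - 1)) t ∧
    (∀ᶠ y in 𝓝 ρ, HasDerivAt (fun y => c * (S - t + e * (y - m) ^ 2) ^ (-α))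
      (-(2 * e * α * c) * ((y - m) * (S - t + e * (y - m) ^ 2) ^ (-α - 1))) y) ∧
    HasDerivAt (fun y => -(2 * e * α * c) * ((y - m) * (S - t + e * (y - m) ^ 2) ^ (-α - 1)))
      (-(2 * e * α * c) * ((S - t + e * (ρ - m) ^ 2) ^ (-α - 1)
        - 2 * e * (α + 1) * (ρ - m) ^ 2 * (S - t + e * (ρ - m) ^ 2) ^ (-α - 2))) ρ := by
  have hin : ∀ y, HasDerivAt (fun y => S - t + e * (y - m) ^ 2) (2 * e * (y - m)) y := by
    intro y
    have := ((((hasDerivAt_id y).sub_const m).pow 2).const_mul e).const_add (S - t)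
    exact this.congr_deriv (by simp; ring)
  refine ⟨?_, ?_, ?_⟩
  · have h1 : HasDerivAt (fun s => S - s + e * (ρ - m) ^ 2) (-1) t := by
      simpa using ((hasDerivAt_id t).const_sub S).add_const (e * (ρ - m) ^ 2)
    have := (h1.rpow_const (p := -α) (Or.inl hpos.ne')).const_mul c
    exact this.congr_deriv (by ring)
  · have hc : ContinuousAt (fun y => S - t + e * (y - m) ^ 2) ρ := (hin ρ).continuousAt
    filter_upwards [hc.eventually (lt_mem_nhds hpos)] with y hy
    have := ((hin y).rpow_const (p := -α) (Or.inl hy.ne')).const_mul c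
    exact this.congr_deriv (by ring)
  · have h1 := ((hin ρ).rpow_const (p := -α - 1) (Or.inl hpos.ne'))
    have := (((hasDerivAt_id ρ).sub_const m).mul h1).const_mul (-(2 * e * α * c))
    rw [show -α - 1 - 1 = -α - 2 by ring] at this
    exact this.congr_deriv (by simp only [id]; ring)

lemma Sol.contOn {D k R T : ℝ} {u f : ℝ → ℝ → ℝ} (h : Sol D k R T u f) {t0 t2 a b : ℝ}
    (h0 : 0 ≤ t0) (h2 : t2 < T) (ha : 0 ≤ a) (hb : b ≤ R) :
    ContinuousOn (Function.uncurry u) (Icc t0 t2 ×ˢ Icc a b) := by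
  refine h.cont.mono ?_
  rintro ⟨s, x⟩ ⟨hs, hx⟩
  exact ⟨⟨h0.trans hs.1, hs.2.trans_lt h2⟩, ⟨ha.trans hx.1, hx.2.trans hb⟩⟩

lemma compare_sub_one {D k t0 t2 a b : ℝ} (u U : ℝ → ℝ → ℝ) (hD : 0 < D)
    (hu : ContinuousOn (Function.uncurry u) (Icc t0 t2 ×ˢ Icc a b))
    (hU : ContinuousOn (Function.uncurry U) (Icc t0 t2 ×ˢ Icc a b))
    (hi : ∀ x ∈ Icc a b, U t0 x < u t0 x)
    (hs : ∀ t ∈ Ioc t0 t2, ∀ x ∈ Icc a b, u t x = U t x → x ∈ Ioo a b ∧ SubB D k u U t x) :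
    ∀ t ∈ Icc t0 t2, ∀ x ∈ Icc a b, U t x < u t x := by
  have := compare_sub (k := k) u (fun _ _ => 1) U (fun _ _ => 0) hD one_pos hu
    continuousOn_const hU continuousOn_const hi (fun _ _ => one_pos)
    (fun t ht x hx h1 _ => hs t ht x hx h1) (fun t ht x hx h1 _ => absurd h1 one_ne_zero)
  exact fun t ht x hx => (this t ht x hx).1

lemma abs_div_le {x m h k : ℝ} (hk : 0 ≤ k) (hx : |x - m| ≤ h) (hhx : h ≤ x)
    (hh : 0 < h) : |k / x * (x - m)| ≤ k := by
  have hx0 : 0 < x := hh.trans_le hhx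
  rw [abs_mul, abs_div, abs_of_nonneg hk, abs_of_pos hx0, div_mul_eq_mul_div, div_le_iff₀ hx0]
  exact mul_le_mul_of_nonneg_left (hx.trans hhx) hk

/-- quadratic-in-space barrier derivatives -/
lemma quad_deriv (c e m x : ℝ) :
    HasDerivAt (fun y => c - e * (y - m) ^ 2) (-(2 * e * (x - m))) x ∧
    HasDerivAt (fun y => -(2 * e * (y - m))) (-(2 * e)) x := by
  constructor
  · have := ((((hasDerivAt_id x).sub_const m).pow 2).const_mul e).const_sub c
    exact this.congr_deriv (by simp; ring)
  · have := (((hasDerivAt_id x).sub_const m).const_mul (2 * e)).neg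
    exact this.congr_deriv (by simp)

lemma heat_lower {D k R T m h t0 A : ℝ} {u f : ℝ → ℝ → ℝ} (hu : Sol D k R T u f) (hD : 0 < D)
    (hk : 0 ≤ k) (hh : 0 < h) (hmh : 2 * h ≤ m) (hmR : m + h < R) (ht0 : 0 < t0)
    (hf : ∀ t ∈ Ioo 0 T, ∀ x ∈ Ioo 0 R, 0 ≤ f t x) (hA : 0 < A)
    (hi : ∀ x ∈ Icc (m - h) (m + h), A < u t0 x) :
    ∀ t ∈ Ico t0 T, ∀ x ∈ Icc (m - h) (m + h),
      A * (1 - (D * (2 * (1 + k) / h ^ 2) + 1) * (t - t0)) - A / h ^ 2 * (x - m) ^ 2 < u t x := by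
  intro t2 ht2 x hx
  set l := D * (2 * (1 + k) / h ^ 2) + 1 with hl
  have hlpos : 0 < l := by positivity
  refine compare_sub_one (k := k) (t0 := t0) (t2 := t2) (a := m - h) (b := m + h) u
    (fun t x => A * (1 - l * (t - t0)) - A / h ^ 2 * (x - m) ^ 2) hD
    (hu.contOn ht0.le ht2.2 (by linarith) hmR.le) (by unfold Function.uncurry; fun_prop) ?_ ?_
      t2 ⟨ht2.1, le_rfl⟩ x hx
  · intro x hx
    have := hi x hx
    have h2 : 0 ≤ A / h ^ 2 * (x - m) ^ 2 := by positivity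
    simp only [sub_self, mul_zero, sub_zero, mul_one]; linarith
  · intro t ht x hx heq
    have htT : t ∈ Ioo 0 T := ⟨ht0.trans ht.1, ht.2.trans_lt ht2.2⟩
    have hxR : x ∈ Ioo 0 R := ⟨by linarith [hx.1], by linarith [hx.2]⟩
    have hnn : 0 ≤ u t x := hu.nn t ⟨htT.1.le, htT.2⟩ x ⟨hxR.1.le, hxR.2.le⟩
    have hneg : (x - m) ^ 2 = h ^ 2 → False := by
      intro hx2
      rw [heq, hx2] at hnn
      have : A / h ^ 2 * h ^ 2 = A := by field_simp
      rw [this] at hnn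
      have : 0 < A * (l * (t - t0)) := mul_pos hA (mul_pos hlpos (sub_pos.2 ht.1))
      linarith
    have hx1 : x ≠ m - h := fun h' => hneg (by rw [h']; ring)
    have hx2 : x ≠ m + h := fun h' => hneg (by rw [h']; ring)
    refine ⟨⟨lt_of_le_of_ne hx.1 (Ne.symm hx1), lt_of_le_of_ne hx.2 hx2⟩, ?_⟩
    have hd := fun y => quad_deriv (A * (1 - l * (t - t0))) (A / h ^ 2) m y
    refine hu.sub htT hxR (Ut := -(A * l)) ?_ (Eventually.of_forall fun y => (hd y).1) (hd x).2 ?_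
    · have := (((((hasDerivAt_id t).sub_const t0).const_mul l).const_sub 1).const_mul A).sub_const
        (A / h ^ 2 * (x - m) ^ 2)
      exact this.congr_deriv (by simp)
    · refine lt_of_lt_of_le ?_ (hf t htT x hxR)
      have hab : |k / x * (x - m)| ≤ k := by
        refine abs_div_le (h := h) hk ?_ (by linarith [hx.1]) hh
        rw [abs_le]; constructor <;> linarith [hx.1, hx.2]
      have h1 := (abs_le.1 hab).2
      have e : -(A * l) - D * (-(2 * (A / h ^ 2)) + k / x * -(2 * (A / h ^ 2) * (x - m)))
        = - A + D * (2 * (A / h ^ 2)) * (k / x * (x - m) - k) := by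
        rw [hl]; field_simp; ring
      rw [e]
      have : D * (2 * (A / h ^ 2)) * (k / x * (x - m) - k) ≤ 0 :=
        mul_nonpos_of_nonneg_of_nonpos (by positivity) (by linarith)
      linarith

lemma heat_lower2 {D k R T m h t0 Q s0 : ℝ} {u f : ℝ → ℝ → ℝ} (hu : Sol D k R T u f) (hD : 0 < D)
    (hk : 0 ≤ k) (hh : 0 < h) (hmh : 2 * h ≤ m) (hmR : m + h < R) (ht0 : 0 < t0)
    (hQ : 0 < Q) (hs0 : 0 < s0)
    (hf : ∀ t ∈ Ioo t0 T, ∀ x ∈ Icc (m - h) (m + h), Q ≤ f t x) :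
    ∀ t ∈ Ico t0 T, ∀ x ∈ Icc (m - h) (m + h),
      Q / 2 * ((t - t0) - D * (1 + k) / h ^ 2 * (t - t0) ^ 2 - s0)
        - Q / 2 * (t - t0) / h ^ 2 * (x - m) ^ 2 < u t x := by
  intro t2 ht2 x hx
  set l := D * (1 + k) / h ^ 2 with hl
  have hlpos : 0 < l := by positivity
  have hB : 0 < Q / 2 := by positivity
  refine compare_sub_one (k := k) (t0 := t0) (t2 := t2) (a := m - h) (b := m + h) u
    (fun t x => Q / 2 * ((t - t0) - l * (t - t0) ^ 2 - s0)
        - Q / 2 * (t - t0) / h ^ 2 * (x - m) ^ 2) hD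
    (hu.contOn ht0.le ht2.2 (by linarith) hmR.le) (by unfold Function.uncurry; fun_prop) ?_ ?_
      t2 ⟨ht2.1, le_rfl⟩ x hx
  · intro x hx
    have hnn : 0 ≤ u t0 x := hu.nn t0 ⟨ht0.le, ht2.1.trans_lt ht2.2⟩ x
      ⟨by linarith [hx.1], by linarith [hx.2]⟩
    simp only [sub_self]
    have := mul_pos hB hs0
    ring_nf
    linarith
  · intro t ht x hx heq
    have htT : t ∈ Ioo 0 T := ⟨ht0.trans ht.1, ht.2.trans_lt ht2.2⟩
    have hxR : x ∈ Ioo 0 R := ⟨by linarith [hx.1], by linarith [hx.2]⟩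
    have hnn : 0 ≤ u t x := hu.nn t ⟨htT.1.le, htT.2⟩ x ⟨hxR.1.le, hxR.2.le⟩
    have htt : 0 < t - t0 := sub_pos.2 ht.1
    have hneg : (x - m) ^ 2 = h ^ 2 → False := by
      intro hx2
      rw [heq, hx2] at hnn
      have : Q / 2 * (t - t0) / h ^ 2 * h ^ 2 = Q / 2 * (t - t0) := by field_simp
      rw [this] at hnn
      have h1 : 0 < Q / 2 * (l * (t - t0) ^ 2 + s0) := by positivity
      linarith
    have hx1 : x ≠ m - h := fun h' => hneg (by rw [h']; ring)
    have hx2 : x ≠ m + h := fun h' => hneg (by rw [h']; ring)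
    refine ⟨⟨lt_of_le_of_ne hx.1 (Ne.symm hx1), lt_of_le_of_ne hx.2 hx2⟩, ?_⟩
    have hd := fun y => quad_deriv (Q / 2 * ((t - t0) - l * (t - t0) ^ 2 - s0))
      (Q / 2 * (t - t0) / h ^ 2) m y
    refine hu.sub htT hxR
      (Ut := Q / 2 * (1 - 2 * l * (t - t0)) - Q / 2 / h ^ 2 * (x - m) ^ 2) ?_
      (Eventually.of_forall fun y => (hd y).1) (hd x).2 ?_
    · have h0 := (hasDerivAt_id t).sub_const t0
      have h1 := ((h0.sub ((h0.pow 2).const_mul l)).sub_const s0).const_mul (Q / 2)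
      have h2 := h1.sub (((h0.const_mul (Q / 2)).div_const (h ^ 2)).mul_const ((x - m) ^ 2))
      exact h2.congr_deriv (by simp only [id]; push_cast; ring)
    · refine lt_of_lt_of_le ?_ (hf t ⟨ht.1, htT.2⟩ x hx)
      have hab : |k / x * (x - m)| ≤ k := by
        refine abs_div_le (h := h) hk ?_ (by linarith [hx.1]) hh
        rw [abs_le]; constructor <;> linarith [hx.1, hx.2]
      have h1 := (abs_le.1 hab).2
      have e : Q / 2 * (1 - 2 * l * (t - t0)) - Q / 2 / h ^ 2 * (x - m) ^ 2
          - D * (-(2 * (Q / 2 * (t - t0) / h ^ 2))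
            + k / x * -(2 * (Q / 2 * (t - t0) / h ^ 2) * (x - m)))
        = Q / 2 - Q / 2 / h ^ 2 * (x - m) ^ 2
          + D * (2 * (Q / 2 * (t - t0) / h ^ 2)) * (k / x * (x - m) - k) := by
        rw [hl]; field_simp; ring
      rw [e]
      have h2 : D * (2 * (Q / 2 * (t - t0) / h ^ 2)) * (k / x * (x - m) - k) ≤ 0 :=
        mul_nonpos_of_nonneg_of_nonpos (by positivity) (by linarith)
      have h3 : 0 ≤ Q / 2 / h ^ 2 * (x - m) ^ 2 := by positivity
      linarith

lemma theta_sub {D k R T : ℝ} {u f : ℝ → ℝ → ℝ} (hu : Sol D k R T u f) (hD : 0 < D)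
    (hk : 0 ≤ k) {S m h L α c p β t x : ℝ} (hα : 0 < α) (hβ : β * p = α + 1)
    (hL : 0 < L) (hcL : α * L * (1 + 2 * D * (1 + k)) < c * L ^ p)
    (ht : t ∈ Ioo 0 T) (hx : x ∈ Ioo 0 R) (hxm : |x - m| ≤ h) (hhx : h ≤ x) (hh : 0 < h)
    (hS : t < S)
    (hf : c * (L * (S - t + 1 * (x - m) ^ 2) ^ (-β)) ^ p ≤ f t x) :
    SubB D k u (fun t x => L * (S - t + 1 * (x - m) ^ 2) ^ (-α)) t x := by
  have hpos : 0 < S - t + 1 * (x - m) ^ 2 := by nlinarith [sq_nonneg (x - m)]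
  obtain ⟨h1, h2, h3⟩ := theta_derivs L S 1 m α t x hpos
  refine hu.sub ht hx h1 h2 h3 (lt_of_lt_of_le ?_ hf)
  rw [Real.mul_rpow hL.le (Real.rpow_nonneg hpos.le _), ← Real.rpow_mul hpos.le,
    show -β * p = -α - 1 by linarith]
  set th := S - t + 1 * (x - m) ^ 2 with hth
  have hP : 0 < th ^ (-α - 1) := Real.rpow_pos_of_pos hpos _
  have hP2 : 0 < th ^ (-α - 2) := Real.rpow_pos_of_pos hpos _
  have hab := (abs_le.1 (abs_div_le (h := h) (k := k) hk hxm hhx hh)).2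
  set P := th ^ (-α - 1) with hPd
  set P2 := th ^ (-α - 2)
  have e : α * L * P - D * (-(2 * 1 * α * L) * (P - 2 * 1 * (α + 1) * (x - m) ^ 2 * P2)
      + k / x * (-(2 * 1 * α * L) * ((x - m) * P)))
      = α * L * P * (1 + 2 * D * (1 + k)) - 4 * D * α * L * (α + 1) * (x - m) ^ 2 * P2
        - 2 * D * α * L * P * (k - k / x * (x - m)) := by ring
  rw [e]
  have i1 : 0 ≤ 4 * D * α * L * (α + 1) * (x - m) ^ 2 * P2 := by positivity
  have i2 : 0 ≤ 2 * D * α * L * P * (k - k / x * (x - m)) :=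
    mul_nonneg (by positivity) (by linarith)
  have i3 := mul_lt_mul_of_pos_right hcL hP
  linarith

lemma blow_sub {D1 D2 k R T : ℝ} {u v f g : ℝ → ℝ → ℝ} (hu : Sol D1 k R T u f)
    (hv : Sol D2 k R T v g) (hD1 : 0 < D1) (hD2 : 0 < D2)
    (hk : 0 ≤ k) {m h L α c p q β t0 σ : ℝ} (hα : 0 < α) (hβ : 0 < β) (hp : 0 < p) (hq : 0 < q)
    (hc : 0 < c)
    (hβp : β * p = α + 1) (hαq : α * q = β + 1)
    (hL : 0 < L) (hcL : α * L * (1 + 2 * D1 * (1 + k)) < c * L ^ p)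
    (hcL2 : β * L * (1 + 2 * D2 * (1 + k)) < c * L ^ q)
    (hf : ∀ t ∈ Ioo 0 T, ∀ x ∈ Ioo 0 R, c * (v t x) ^ p ≤ f t x)
    (hg : ∀ t ∈ Ioo 0 T, ∀ x ∈ Ioo 0 R, c * (u t x) ^ q ≤ g t x)
    (hh : 0 < h) (hmh : 2 * h ≤ m) (hmR : m + h < R) (ht0 : 0 < t0) (hσ : 0 < σ)
    (hσT : t0 + σ < T) (hσh : σ ≤ h ^ 2)
    (hlu : ∀ t ∈ Icc t0 (t0 + σ), ∀ x ∈ Icc (m - h) (m + h), L * σ ^ (-α) < u t x)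
    (hlv : ∀ t ∈ Icc t0 (t0 + σ), ∀ x ∈ Icc (m - h) (m + h), L * σ ^ (-β) < v t x) : False := by
  set S := t0 + σ with hS
  have key : ∀ a : ℝ, 0 < a → ∀ t x : ℝ, σ ≤ S - t + 1 * (x - m) ^ 2 →
      L * (S - t + 1 * (x - m) ^ 2) ^ (-a) ≤ L * σ ^ (-a) := by
    intro a ha t x hx
    exact mul_le_mul_of_nonneg_left
      (Real.rpow_le_rpow_of_nonpos hσ hx (by linarith)) hL.le
  have hcont : ∀ a t2 : ℝ, t2 < S → ContinuousOn (Function.uncurry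
      (fun t x => L * (S - t + 1 * (x - m) ^ 2) ^ (-a))) (Icc t0 t2 ×ˢ Icc (m - h) (m + h)) := by
    intro a t2 ht2
    unfold Function.uncurry
    refine continuousOn_const.mul (ContinuousOn.rpow_const (by fun_prop) ?_)
    rintro ⟨t, x⟩ ⟨ht, hx⟩
    left
    have := ht.2
    simp only at this ⊢
    nlinarith [sq_nonneg (x - m)]
  have hmain : ∀ t2 ∈ Ico t0 S, L * (S - t2) ^ (-α) < u t2 m := by
    intro t2 ht2
    have := compare_sub (k := k) (t0 := t0) (t2 := t2) (a := m - h) (b := m + h) u v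
      (fun t x => L * (S - t + 1 * (x - m) ^ 2) ^ (-α))
      (fun t x => L * (S - t + 1 * (x - m) ^ 2) ^ (-β)) hD1 hD2
      (hu.contOn ht0.le (ht2.2.trans hσT) (by linarith) hmR.le)
      (hv.contOn ht0.le (ht2.2.trans hσT) (by linarith) hmR.le)
      (hcont _ _ ht2.2) (hcont _ _ ht2.2)
      (fun x hx => lt_of_le_of_lt (key α hα t0 x (by nlinarith [sq_nonneg (x - m)]))
        (hlu t0 ⟨le_rfl, by linarith⟩ x hx))
      (fun x hx => lt_of_le_of_lt (key β hβ t0 x (by nlinarith [sq_nonneg (x - m)]))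
        (hlv t0 ⟨le_rfl, by linarith⟩ x hx))
      (by
        intro t ht x hx heq hle
        have htT : t ∈ Ioo 0 T := ⟨ht0.trans ht.1, by linarith [ht.2, ht2.2]⟩
        have hxR : x ∈ Ioo 0 R := ⟨by linarith [hx.1], by linarith [hx.2]⟩
        have htS : t < S := ht.2.trans_lt ht2.2
        have hneg : (x - m) ^ 2 = h ^ 2 → False := by
          intro hx2
          have h1 := hlu t ⟨ht.1.le, htS.le⟩ x hx
          have h2 := key α hα t x (by nlinarith)
          linarith
        have hx1 : x ≠ m - h := fun h' => hneg (by rw [h']; ring)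
        have hx2 : x ≠ m + h := fun h' => hneg (by rw [h']; ring)
        refine ⟨⟨lt_of_le_of_ne hx.1 (Ne.symm hx1), lt_of_le_of_ne hx.2 hx2⟩, ?_⟩
        refine theta_sub hu hD1 hk (h := h) hα hβp hL hcL htT hxR ?_ (by linarith [hx.1]) hh htS ?_
        · rw [abs_le]; constructor <;> linarith [hx.1, hx.2]
        · refine le_trans (mul_le_mul_of_nonneg_left ?_ hc.le) (hf t htT x hxR)
          refine Real.rpow_le_rpow ?_ hle hp.le
          exact mul_nonneg hL.le (Real.rpow_nonneg (by nlinarith [sq_nonneg (x - m)]) _))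
      (by
        intro t ht x hx heq hle
        have htT : t ∈ Ioo 0 T := ⟨ht0.trans ht.1, by linarith [ht.2, ht2.2]⟩
        have hxR : x ∈ Ioo 0 R := ⟨by linarith [hx.1], by linarith [hx.2]⟩
        have htS : t < S := ht.2.trans_lt ht2.2
        have hneg : (x - m) ^ 2 = h ^ 2 → False := by
          intro hx2
          have h1 := hlv t ⟨ht.1.le, htS.le⟩ x hx
          have h2 := key β hβ t x (by nlinarith)
          linarith
        have hx1 : x ≠ m - h := fun h' => hneg (by rw [h']; ring)
        have hx2 : x ≠ m + h := fun h' => hneg (by rw [h']; ring)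
        refine ⟨⟨lt_of_le_of_ne hx.1 (Ne.symm hx1), lt_of_le_of_ne hx.2 hx2⟩, ?_⟩
        refine theta_sub hv hD2 hk (h := h) hβ hαq hL hcL2 htT hxR ?_ (by linarith [hx.1]) hh htS ?_
        · rw [abs_le]; constructor <;> linarith [hx.1, hx.2]
        · refine le_trans (mul_le_mul_of_nonneg_left ?_ hc.le) (hg t htT x hxR)
          refine Real.rpow_le_rpow ?_ hle hq.le
          exact mul_nonneg hL.le (Real.rpow_nonneg (by nlinarith [sq_nonneg (x - m)]) _))
      t2 ⟨ht2.1, le_rfl⟩ m ⟨by linarith, by linarith⟩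
    simpa using this.1
  -- contradiction with boundedness
  have hcu : ContinuousOn (fun t => u t m) (Icc t0 S) := by
    have := hu.contOn (t0 := t0) (t2 := S) (a := m - h) (b := m + h) ht0.le hσT (by linarith) hmR.le
    refine this.comp (f := fun t => (t, m)) (by fun_prop) ?_
    intro t ht; exact ⟨ht, ⟨by linarith, by linarith⟩⟩
  obtain ⟨C, hC⟩ := (isCompact_Icc.image_of_continuousOn hcu).bddAbove
  have hlim : Tendsto (fun t : ℝ => L * (S - t) ^ (-α)) (𝓝[<] S) atTop := by
    refine Tendsto.const_mul_atTop hL ?_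
    refine (tendsto_rpow_neg_nhdsGT_zero (by linarith : -α < 0)).comp ?_
    refine tendsto_nhdsWithin_iff.2 ⟨?_, ?_⟩
    · have : Tendsto (fun t : ℝ => S - t) (𝓝 S) (𝓝 (S - S)) := by
        exact (continuous_const.sub continuous_id).tendsto S
      rw [sub_self] at this
      exact this.mono_left nhdsWithin_le_nhds
    · filter_upwards [self_mem_nhdsWithin] with t ht
      exact mem_Ioi.2 (sub_pos.2 (mem_Iio.1 ht))
  have hev := (hlim.eventually (eventually_gt_atTop C)).and
    (Ioo_mem_nhdsLT (show t0 < S by linarith))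
  obtain ⟨t, h1, h2⟩ := hev.exists
  have h3 := hmain t ⟨h2.1.le, h2.2⟩
  have h4 : u t m ≤ C := hC ⟨t, ⟨h2.1.le, h2.2.le⟩, rfl⟩
  linarith

set_option maxHeartbeats 1000000 in
lemma typeI (D1 D2 k R T α β p q c d : ℝ) (hD1 : 0 < D1) (hD2 : 0 < D2)
    (hk : 0 ≤ k) (hT : 0 < T) (hα : 0 < α) (hβ : 0 < β) (hp : 1 < p) (hq : 1 < q)
    (hβp : β * p = α + 1) (hαq : α * q = β + 1) (hc : 0 < c) (hd : 0 < d) (hdR : d < R) :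
    ∃ M0 : ℝ, ∃ τ1 > (0:ℝ), τ1 < T ∧ ∀ u v f g : ℝ → ℝ → ℝ,
      Sol D1 k R T u f → Sol D2 k R T v g →
      (∀ t ∈ Ioo 0 T, ∀ x ∈ Ioo 0 R, c * (v t x) ^ p ≤ f t x) →
      (∀ t ∈ Ioo 0 T, ∀ x ∈ Ioo 0 R, c * (u t x) ^ q ≤ g t x) →
      ∀ M ≥ M0, ∀ t, T - τ1 ≤ t → t < T → u t d < M * (T - t) ^ (-α) := by
  have hlarge : ∀ p B : ℝ, 1 < p → ∀ᶠ L : ℝ in atTop, B * L < c * L ^ p := by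
    intro p B hp
    have h1 := (tendsto_rpow_atTop (show 0 < p - 1 by linarith)).const_mul_atTop hc
    filter_upwards [h1.eventually (eventually_gt_atTop B), eventually_gt_atTop 0] with L h2 h3
    have : L ^ p = L ^ (p - 1) * L := by
      rw [← Real.rpow_add_one h3.ne']; simp
    rw [this, ← mul_assoc]
    exact mul_lt_mul_of_pos_right h2 h3
  obtain ⟨L, hL1, hL2, hL⟩ := ((hlarge p (α * (1 + 2 * D1 * (1 + k))) hp).and
    ((hlarge q (β * (1 + 2 * D2 * (1 + k))) hq).and (eventually_gt_atTop (0:ℝ)))).exists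
  set w := d / 4 with hw
  have hw0 : 0 < w := by positivity
  have hM : ∀ᶠ M : ℝ in atTop, 4 * (4 ^ α * L) ≤ M ∧ 0 < M ∧
      L * 4 ^ β ≤ c / 16 * (M / 4) ^ q := by
    refine (eventually_ge_atTop _).and ((eventually_gt_atTop 0).and ?_)
    have h1 : Tendsto (fun M : ℝ => c / 16 * (M / 4) ^ q) atTop atTop :=
      Tendsto.const_mul_atTop (by positivity) ((tendsto_rpow_atTop (by linarith)).comp
        (tendsto_id.atTop_div_const (by norm_num)))
    exact h1.eventually (eventually_ge_atTop _)
  obtain ⟨M0, hM0⟩ := eventually_atTop.1 hM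
  set l := D1 * (2 * (1 + k) / w ^ 2) + 1 with hl
  have hl0 : 0 < l := by positivity
  set μ := D2 * (1 + k) / (w / 2) ^ 2 with hμ
  have hμ0 : 0 < μ := by positivity
  set τ1 := min (T / 2) (min (1 / (4 * l)) (min (1 / (4 * μ)) (w ^ 2 / 4))) with hτ1
  have hτ1pos : 0 < τ1 := by
    rw [hτ1]; simp only [lt_min_iff]; refine ⟨?_, ?_, ?_, ?_⟩ <;> positivity
  refine ⟨M0, τ1, hτ1pos, lt_of_le_of_lt (min_le_left _ _) (by linarith), ?_⟩
  intro u v f g hu hv hf hg M hMge t0 ht0 ht0T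
  obtain ⟨hMa, hMpos, hMb⟩ := hM0 M hMge
  by_contra hcon
  push Not at hcon
  set τ := T - t0 with hτ
  have hτpos : 0 < τ := by linarith
  have hττ : τ ≤ τ1 := by linarith
  have q1 : τ ≤ T / 2 := hττ.trans (min_le_left _ _)
  have q2 : l * τ ≤ 1 / 4 := by
    have : τ ≤ 1 / (4 * l) := hττ.trans ((min_le_right _ _).trans (min_le_left _ _))
    rw [le_div_iff₀ (by positivity)] at this; linarith
  have q3 : μ * τ ≤ 1 / 4 := by
    have : τ ≤ 1 / (4 * μ) :=
      hττ.trans ((min_le_right _ _).trans ((min_le_right _ _).trans (min_le_left _ _)))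
    rw [le_div_iff₀ (by positivity)] at this; linarith
  have q4 : τ ≤ w ^ 2 / 4 :=
    hττ.trans ((min_le_right _ _).trans ((min_le_right _ _).trans (min_le_right _ _)))
  have ht00 : 0 < t0 := by linarith
  have hτα : 0 < τ ^ (-α) := Real.rpow_pos_of_pos hτpos _
  set A := M * τ ^ (-α) / 2 with hA
  have hApos : 0 < A := by positivity
  have hfnn : ∀ t ∈ Ioo 0 T, ∀ x ∈ Ioo 0 R, 0 ≤ f t x := by
    intro t ht x hx
    refine le_trans (mul_nonneg hc.le (Real.rpow_nonneg (hv.nn t ⟨ht.1.le, ht.2⟩ x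
      ⟨hx.1.le, hx.2.le⟩) _)) (hf t ht x hx)
  have hd4 : d = 4 * w := by rw [hw]; ring
  have s1 := heat_lower (m := 2 * w) (h := w) (A := A) hu hD1 hk hw0 le_rfl (by linarith) ht00
    hfnn hApos (by
      intro x hx
      have : u t0 d ≤ u t0 x := hu.anti t0 ⟨ht00.le, ht0T⟩ ⟨by linarith [hx.1], by linarith [hx.2]⟩
        ⟨hd.le, hdR.le⟩ (by linarith [hx.2])
      have h2 : A < M * τ ^ (-α) := by rw [hA]; linarith [mul_pos hMpos hτα]
      linarith)
  have s1' : ∀ t ∈ Ico t0 T, ∀ x ∈ Icc (2 * w - w / 2) (2 * w + w / 2), A / 2 < u t x := by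
    intro t ht x hx
    have := s1 t ht x ⟨by linarith [hx.1], by linarith [hx.2]⟩
    refine lt_of_le_of_lt ?_ this
    have h1 : (x - 2 * w) ^ 2 ≤ w ^ 2 / 4 := by nlinarith [hx.1, hx.2]
    have h2 : A / w ^ 2 * (x - 2 * w) ^ 2 ≤ A / 4 := by
      calc A / w ^ 2 * (x - 2 * w) ^ 2 ≤ A / w ^ 2 * (w ^ 2 / 4) := by gcongr
        _ = A / 4 := by field_simp
    have h3 : l * (t - t0) ≤ 1 / 4 := by
      refine le_trans (mul_le_mul_of_nonneg_left ?_ hl0.le) q2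
      linarith [ht.2]
    have h4 := mul_le_mul_of_nonneg_left h3 hApos.le
    linarith
  set Q := c * (A / 2) ^ q with hQ
  have hQpos : 0 < Q := mul_pos hc (Real.rpow_pos_of_pos (by positivity) _)
  have s2 := heat_lower2 (m := 2 * w) (h := w / 2) (Q := Q) (s0 := τ / 8) hv hD2 hk (by positivity)
    (by linarith) (by linarith) ht00 hQpos (by positivity) (by
      intro t ht x hx
      refine le_trans ?_ (hg t ⟨ht00.trans ht.1, ht.2⟩ x ⟨by linarith [hx.1], by linarith [hx.2]⟩)
      refine mul_le_mul_of_nonneg_left ?_ hc.le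
      exact Real.rpow_le_rpow (by positivity) (s1' t ⟨ht.1.le, ht.2⟩ x hx).le (by linarith))
  have s2' : ∀ t ∈ Ico (t0 + τ / 2) T, ∀ x ∈ Icc (2 * w - w / 4) (2 * w + w / 4),
      Q / 2 * (τ / 8) < v t x := by
    intro t ht x hx
    have := s2 t ⟨by linarith [ht.1], ht.2⟩ x ⟨by linarith [hx.1], by linarith [hx.2]⟩
    refine lt_of_le_of_lt ?_ this
    have h1 : (x - 2 * w) ^ 2 ≤ w ^ 2 / 16 := by nlinarith [hx.1, hx.2]
    have htt : 0 < t - t0 := by linarith [ht.1]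
    have h2 : Q / 2 * (t - t0) / (w / 2) ^ 2 * (x - 2 * w) ^ 2 ≤ Q / 2 * ((t - t0) / 4) := by
      calc Q / 2 * (t - t0) / (w / 2) ^ 2 * (x - 2 * w) ^ 2
          ≤ Q / 2 * (t - t0) / (w / 2) ^ 2 * (w ^ 2 / 16) := by gcongr
        _ = Q / 2 * ((t - t0) / 4) := by field_simp; norm_num
    have h3 : μ * (t - t0) ≤ 1 / 4 := by
      refine le_trans (mul_le_mul_of_nonneg_left ?_ hμ0.le) q3
      linarith [ht.2]
    have h4 := mul_le_mul_of_nonneg_right h3 htt.le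
    have h5 : τ / 8 ≤ (t - t0) - μ * (t - t0) ^ 2 - τ / 8 - (t - t0) / 4 := by
      have := ht.1
      nlinarith
    have h6 := mul_le_mul_of_nonneg_left h5 (show 0 ≤ Q / 2 by positivity)
    linarith
  have hσ : ∀ a : ℝ, (τ / 4) ^ (-a) = 4 ^ a * τ ^ (-a) := by
    intro a
    rw [Real.div_rpow hτpos.le (by norm_num), Real.rpow_neg (by norm_num : (0:ℝ) ≤ 4), div_inv_eq_mul,
      mul_comm]
  refine blow_sub hu hv hD1 hD2 hk (m := 2 * w) (h := w / 4) (t0 := t0 + τ / 2) (σ := τ / 4)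
    hα hβ (by linarith) (by linarith) hc hβp hαq hL (by linarith) (by linarith) hf hg
    (by positivity) (by linarith) (by linarith) (by linarith) (by linarith) (by linarith)
    (by linarith) ?_ ?_
  · intro t ht x hx
    refine lt_of_le_of_lt ?_ (s1' t ⟨by linarith [ht.1], by linarith [ht.2]⟩ x
      ⟨by linarith [hx.1], by linarith [hx.2]⟩)
    rw [hσ, hA]
    have := mul_le_mul_of_nonneg_right hMa hτα.le
    linarith
  · intro t ht x hx
    refine lt_of_le_of_lt ?_ (s2' t ⟨by linarith [ht.1], by linarith [ht.2]⟩ x hx)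
    rw [hσ, hQ, hA]
    have e1 : (M * τ ^ (-α) / 2 / 2) ^ q = (M / 4) ^ q * τ ^ (-β - 1) := by
      rw [show M * τ ^ (-α) / 2 / 2 = M / 4 * τ ^ (-α) by ring,
        Real.mul_rpow (by positivity) hτα.le, ← Real.rpow_mul hτpos.le,
        show -α * q = -β - 1 by linarith]
    have e2 : τ ^ (-β - 1) * τ = τ ^ (-β) := by
      rw [← Real.rpow_add_one hτpos.ne']; simp
    rw [e1]
    have := mul_le_mul_of_nonneg_right hMb (Real.rpow_nonneg hτpos.le (-β))
    rw [← e2] at this ⊢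
    linarith

lemma moving_derivs (T a b η M α t x : ℝ) (ht : t < T) :
    HasDerivAt (fun s => (T - s) ^ (-α) * (η + M * Real.exp (-((x - a) / √(T - s) + b))))
      ((T - t) ^ (-α - 1) * (α * (η + M * Real.exp (-((x - a) / √(T - t) + b)))
        - M * Real.exp (-((x - a) / √(T - t) + b)) * ((x - a) / √(T - t)) / 2)) t ∧
    (∀ y, HasDerivAt (fun y => (T - t) ^ (-α) * (η + M * Real.exp (-((y - a) / √(T - t) + b))))
      (-((T - t) ^ (-α) / √(T - t) * (M * Real.exp (-((y - a) / √(T - t) + b))))) y) ∧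
    HasDerivAt (fun y => (-((T - t) ^ (-α) / √(T - t) * (M * Real.exp (-((y - a) / √(T - t) + b))))))
      ((T - t) ^ (-α - 1) * (M * Real.exp (-((x - a) / √(T - t) + b)))) x := by
  have hs : 0 < T - t := sub_pos.2 ht
  have hq : 0 < √(T - t) := Real.sqrt_pos.2 hs
  have hqq : √(T - t) * √(T - t) = T - t := Real.mul_self_sqrt hs.le
  have hP : (T - t) ^ (-α) = (T - t) ^ (-α - 1) * (T - t) := by
    rw [← Real.rpow_add_one hs.ne']; simp
  have hexp : ∀ y, HasDerivAt (fun y => Real.exp (-((y - a) / √(T - t) + b)))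
      (Real.exp (-((y - a) / √(T - t) + b)) * (-(1 / √(T - t)))) y := by
    intro y
    exact ((((((hasDerivAt_id y).sub_const a).div_const (√(T - t))).add_const b).neg).exp)
  refine ⟨?_, ?_, ?_⟩
  · have h1 : HasDerivAt (fun s => T - s) (-1) t := by
      simpa using (hasDerivAt_id t).const_sub T
    have h2 := h1.rpow_const (p := -α) (Or.inl hs.ne')
    have h3 := h1.sqrt hs.ne'
    have h4 := ((((hasDerivAt_const t (x - a)).div h3 hq.ne').add_const b).neg).exp
    have h5 := h2.mul ((h4.const_mul M).const_add η)
    refine h5.congr_deriv ?_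
    simp only [Pi.div_apply]
    rw [hP]
    generalize hE : Real.exp (-((x - a) / √(T - t) + b)) = E
    generalize (T - t) ^ (-α - 1) = P
    generalize hQ : √(T - t) = Q at *
    rw [← hqq]
    field_simp
    ring
  · intro y
    have := (((hexp y).const_mul M).const_add η).const_mul ((T - t) ^ (-α))
    exact this.congr_deriv (by ring)
  · have := (((hexp x).const_mul M).const_mul ((T - t) ^ (-α) / √(T - t))).neg
    refine this.congr_deriv ?_
    rw [hP]
    generalize Real.exp (-((x - a) / √(T - t) + b)) = E
    generalize (T - t) ^ (-α - 1) = P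
    generalize hQ : √(T - t) = Q at *
    rw [← hqq]
    field_simp

lemma pow_identity {s W α β p r c : ℝ} (hs : 0 < s) (hW : 0 ≤ W) (hβ : β * p = α + 1)
    (hr : α * r = α + 1) :
    c * ((s ^ (-β) * W) ^ p + (s ^ (-α) * W) ^ r + 1)
      = s ^ (-α - 1) * (c * (W ^ p + W ^ r + s ^ (α + 1))) := by
  rw [Real.mul_rpow (Real.rpow_nonneg hs.le _) hW, Real.mul_rpow (Real.rpow_nonneg hs.le _) hW,
    ← Real.rpow_mul hs.le, ← Real.rpow_mul hs.le, show -β * p = -α - 1 by linarith,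
    show -α * r = -α - 1 by linarith]
  have : s ^ (-α - 1) * s ^ (α + 1) = 1 := by
    rw [← Real.rpow_add hs]; simp
  linear_combination (-c) * this

lemma moving_sup {D k R T : ℝ} {u f : ℝ → ℝ → ℝ} (hu : Sol D k R T u f) (hD : 0 < D)
    (hk : 0 ≤ k) {a b η M α β p r c t x : ℝ} (hβ : β * p = α + 1) (hr : α * r = α + 1)
    (hη : 0 < η) (hM : 0 < M)
    (ht : t ∈ Ioo 0 T) (hx : x ∈ Ioo 0 R) (E : ℝ)
    (hE : E = M * Real.exp (-((x - a) / √(T - t) + b)))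
    (hnum : c * ((η + E) ^ p + (η + E) ^ r + (T - t) ^ (α + 1))
      < α * (η + E) - E * ((x - a) / √(T - t)) / 2 - D * E)
    (hf : f t x ≤ c * (((T - t) ^ (-β) * (η + E)) ^ p + ((T - t) ^ (-α) * (η + E)) ^ r + 1)) :
    SupB D k u (fun t x => (T - t) ^ (-α) * (η + M * Real.exp (-((x - a) / √(T - t) + b)))) t x := by
  have hs : 0 < T - t := sub_pos.2 ht.2
  obtain ⟨h1, h2, h3⟩ := moving_derivs T a b η M α t x ht.2
  refine hu.sup ht hx h1 (Eventually.of_forall h2) h3 (lt_of_le_of_lt hf ?_)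
  have hE0 : 0 < E := by rw [hE]; positivity
  rw [pow_identity hs (by positivity) hβ hr, ← hE]
  have hP : 0 < (T - t) ^ (-α - 1) := Real.rpow_pos_of_pos hs _
  have hP0 : 0 < (T - t) ^ (-α) := Real.rpow_pos_of_pos hs _
  have i1 := mul_lt_mul_of_pos_left hnum hP
  have i2 : 0 ≤ D * (k / x * ((T - t) ^ (-α) / √(T - t) * E)) := by
    have := hx.1
    positivity
  linarith

lemma num_moving {η M Λ D K α p r c s y : ℝ} (hη : 0 < η) (hM : 0 < M) (hΛ0 : 0 ≤ Λ) (hD : 0 < D)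
    (hα : 0 < α) (hp : 0 < p) (hr : 0 < r) (hc : 0 < c)
    (h1 : c * ((2 * η) ^ p + (2 * η) ^ r) ≤ α * η / 4)
    (h2 : ∀ z, 0 < z → z ≤ M → c * ((2 * z) ^ p + (2 * z) ^ r) ≤ Λ * z)
    (h3 : c * s ^ (α + 1) ≤ α * η / 4) (hK : 0 < K) (hK1 : 2 * (D + Λ) ≤ K)
    (hK2 : 4 * M ≤ K * (α * η)) (hy : 0 < y) :
    c * ((η + M * Real.exp (-y)) ^ p + (η + M * Real.exp (-y)) ^ r + s ^ (α + 1))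
      < α * (η + M * Real.exp (-y)) - M * Real.exp (-y) * (y - 2 * K) / 2
        - D * (M * Real.exp (-y)) := by
  have hexp1 : Real.exp (-y) ≤ 1 := Real.exp_le_one_iff.2 (by linarith)
  set E := M * Real.exp (-y) with hE
  have hE0 : 0 < E := by positivity
  have hEM : E ≤ M := by nlinarith
  have hW : c * ((η + E) ^ p + (η + E) ^ r) ≤ α * η / 4 + Λ * E := by
    rcases le_total E η with h | h
    · have : c * ((η + E) ^ p + (η + E) ^ r) ≤ c * ((2 * η) ^ p + (2 * η) ^ r) := by
        gcongr <;> linarith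
      have : 0 ≤ Λ * E := by positivity
      linarith
    · have : c * ((η + E) ^ p + (η + E) ^ r) ≤ c * ((2 * E) ^ p + (2 * E) ^ r) := by
        gcongr <;> linarith
      have := h2 E hE0 hEM
      have : 0 < α * η := by positivity
      linarith
  have hαη : 0 < α * η := by positivity
  have hαE : 0 < α * E := by positivity
  suffices 0 < α * η / 2 + α * E + E * (K - D - Λ) - E * y / 2 by nlinarith
  rcases le_total y K with h | h
  · have : 0 ≤ E * (K - D - Λ - y / 2) := mul_nonneg hE0.le (by linarith)
    nlinarith
  · have i1 : 0 ≤ E * (K - D - Λ) := mul_nonneg hE0.le (by linarith)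
    have i2 : y ^ 2 / 2 * Real.exp (-y) ≤ 1 := by
      have := Real.quadratic_le_exp_of_nonneg hy.le
      rw [Real.exp_neg, ← div_eq_mul_inv, div_le_one (Real.exp_pos y)]
      linarith
    have i3 : K * (E * y / 2) ≤ M := by
      calc K * (E * y / 2) ≤ y * (E * y / 2) := by gcongr
        _ = M * (y ^ 2 / 2 * Real.exp (-y)) := by rw [hE]; ring
        _ ≤ M * 1 := by gcongr
        _ = M := mul_one M
    have i4 : E * y / 2 ≤ α * η / 4 := by
      by_contra hcon
      push Not at hcon
      have := mul_lt_mul_of_pos_left hcon hK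
      linarith
    linarith

lemma theta_sup {D k R T : ℝ} {u f : ℝ → ℝ → ℝ} (hu : Sol D k R T u f) (hD : 0 < D)
    (hk : 0 ≤ k) {e m κ α β p r c t x : ℝ} (hα : 0 < α) (hβ : β * p = α + 1) (hr : α * r = α + 1)
    (hκ : 0 < κ) (he : 0 < e) (heD : D * (4 * (α + 1) * e) ≤ 1 / 2)
    (ht : t ∈ Ioo 0 T) (hx : x ∈ Ioo 0 R) (hxm : m ≤ x)
    (hnum : c * (κ ^ p + κ ^ r + (T - t + e * (x - m) ^ 2) ^ (α + 1)) < α * κ / 2)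
    (hf : f t x ≤ c * ((κ * (T - t + e * (x - m) ^ 2) ^ (-β)) ^ p
      + (κ * (T - t + e * (x - m) ^ 2) ^ (-α)) ^ r + 1)) :
    SupB D k u (fun t x => κ * (T - t + e * (x - m) ^ 2) ^ (-α)) t x := by
  have hs : 0 < T - t := sub_pos.2 ht.2
  have hpos : 0 < T - t + e * (x - m) ^ 2 := by positivity
  obtain ⟨h1, h2, h3⟩ := theta_derivs κ T e m α t x hpos
  refine hu.sup ht hx h1 h2 h3 (lt_of_le_of_lt hf ?_)
  rw [mul_comm κ, mul_comm κ, pow_identity hpos hκ.le hβ hr]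
  have hPP : (T - t + e * (x - m) ^ 2) ^ (-α - 1)
      = (T - t + e * (x - m) ^ 2) ^ (-α - 2) * (T - t + e * (x - m) ^ 2) := by
    rw [← Real.rpow_add_one hpos.ne']; ring_nf
  have hP : 0 < (T - t + e * (x - m) ^ 2) ^ (-α - 1) := Real.rpow_pos_of_pos hpos _
  have hP2 : 0 < (T - t + e * (x - m) ^ 2) ^ (-α - 2) := Real.rpow_pos_of_pos hpos _
  refine (mul_lt_mul_of_pos_left hnum hP).trans_le ?_
  have hle : e * (x - m) ^ 2 * (T - t + e * (x - m) ^ 2) ^ (-α - 2)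
      ≤ (T - t + e * (x - m) ^ 2) ^ (-α - 1) := by
    rw [hPP, mul_comm]
    exact mul_le_mul_of_nonneg_left (by linarith) hP2.le
  generalize (T - t + e * (x - m) ^ 2) ^ (-α - 1) = P at *
  generalize (T - t + e * (x - m) ^ 2) ^ (-α - 2) = P2 at *
  have i1 : 0 ≤ D * (k / x * (2 * e * α * κ * ((x - m) * P))) := by
    have := hx.1
    have : 0 ≤ x - m := by linarith
    positivity
  have i2 : 0 ≤ D * (2 * e * α * κ * P) := by positivity
  have i3 := mul_le_mul_of_nonneg_left hle (show 0 ≤ D * (4 * e * α * κ * (α + 1)) by positivity)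
  have i4 := mul_le_mul_of_nonneg_right heD (show 0 ≤ α * κ * P by positivity)
  linarith

lemma small_rpow (p r c B a : ℝ) (hp : 1 < p) (hr : 1 < r) (hB : 0 < B) (ha : 0 < a) :
    ∀ᶠ z : ℝ in 𝓝[>] 0, c * ((a * z) ^ p + (a * z) ^ r) ≤ B * z := by
  have h1 : ∀ p : ℝ, 1 < p → Tendsto (fun z : ℝ => z ^ (p - 1)) (𝓝 0) (𝓝 0) := by
    intro p hp
    have := (Real.continuousAt_rpow_const 0 (p - 1) (Or.inr (by linarith))).tendsto
    rwa [Real.zero_rpow (by linarith)] at this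
  have h2 : Tendsto (fun z : ℝ => c * (a ^ p * z ^ (p - 1) + a ^ r * z ^ (r - 1))) (𝓝 0) (𝓝 0) := by
    have := (((h1 p hp).const_mul (a ^ p)).add ((h1 r hr).const_mul (a ^ r))).const_mul c
    simpa using this
  filter_upwards [(h2.mono_left nhdsWithin_le_nhds).eventually (gt_mem_nhds hB),
    self_mem_nhdsWithin] with z hz hz0
  have hz0' : 0 < z := hz0
  have e : ∀ p : ℝ, (a * z) ^ p = a ^ p * z ^ (p - 1) * z := by
    intro p
    rw [Real.mul_rpow ha.le hz0'.le, mul_assoc, ← Real.rpow_add_one hz0'.ne']; simp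
  rw [e p, e r]
  have := mul_le_mul_of_nonneg_right hz.le hz0'.le
  linarith

lemma large_lin (p r c M : ℝ) (hp : 1 < p) (hr : 1 < r) (hc : 0 < c) :
    ∃ Λ ≥ (0:ℝ), ∀ z, 0 < z → z ≤ M → c * ((2 * z) ^ p + (2 * z) ^ r) ≤ Λ * z := by
  refine ⟨c * (2 ^ p * |M| ^ (p - 1) + 2 ^ r * |M| ^ (r - 1)), by positivity, ?_⟩
  intro z hz hzM
  have e : ∀ p : ℝ, (2 * z) ^ p = 2 ^ p * z ^ (p - 1) * z := by
    intro p
    rw [Real.mul_rpow (by norm_num) hz.le, mul_assoc, ← Real.rpow_add_one hz.ne']; simp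
  rw [e p, e r]
  have hzM' : z ≤ |M| := hzM.trans (le_abs_self M)
  calc c * (2 ^ p * z ^ (p - 1) * z + 2 ^ r * z ^ (r - 1) * z)
      = c * (2 ^ p * z ^ (p - 1) + 2 ^ r * z ^ (r - 1)) * z := by ring
    _ ≤ _ := by
      have i1 : z ^ (p - 1) ≤ |M| ^ (p - 1) := Real.rpow_le_rpow hz.le hzM' (by linarith)
      have i2 : z ^ (r - 1) ≤ |M| ^ (r - 1) := Real.rpow_le_rpow hz.le hzM' (by linarith)
      gcongr

lemma step2_side {D k R T : ℝ} {u f : ℝ → ℝ → ℝ} (hu : Sol D k R T u f) (hD : 0 < D)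
    (hk : 0 ≤ k) {d η M Λ K α β p r c t1 : ℝ} (hα : 0 < α) (hβ : β * p = α + 1)
    (hr : α * r = α + 1) (hp0 : 0 < p) (hr0 : 0 < r) (hc : 0 < c) (hd : 0 < d)
    (hη : 0 < η) (hM : 0 < M) (hΛ0 : 0 ≤ Λ)
    (h1 : c * ((2 * η) ^ p + (2 * η) ^ r) ≤ α * η / 4)
    (h2 : ∀ z, 0 < z → z ≤ M → c * ((2 * z) ^ p + (2 * z) ^ r) ≤ Λ * z)
    (h3 : c * (T - t1) ^ (α + 1) ≤ α * η / 4) (hK : 0 < K) (hK1 : 2 * (D + Λ) ≤ K)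
    (hK2 : 4 * M ≤ K * (α * η)) (ht1 : 0 < t1)
    (hty : ∀ t, t1 ≤ t → t < T → u t d < M * (T - t) ^ (-α))
    (huR : ∀ t ∈ Ioo 0 T, u t R = 0)
    {t x : ℝ} (ht : t1 < t) (htT : t < T) (hx : x ∈ Icc d R)
    (heq : u t x = (T - t) ^ (-α) *
      (η + M * Real.exp (-((x - (d + 2 * K * √(T - t1))) / √(T - t) + 2 * K))))
    (hf : x ∈ Ioo 0 R → f t x ≤ c * (((T - t) ^ (-β) *
        (η + M * Real.exp (-((x - (d + 2 * K * √(T - t1))) / √(T - t) + 2 * K)))) ^ p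
      + (u t x) ^ r + 1)) :
    x ∈ Ioo d R ∧ SupB D k u (fun t x => (T - t) ^ (-α) *
      (η + M * Real.exp (-((x - (d + 2 * K * √(T - t1))) / √(T - t) + 2 * K)))) t x := by
  have hs : 0 < T - t := sub_pos.2 htT
  have hsq : 0 < √(T - t) := Real.sqrt_pos.2 hs
  have hP : 0 < (T - t) ^ (-α) := Real.rpow_pos_of_pos hs _
  have ht0 : 0 < t := ht1.trans ht
  have hdR : d ≤ R := hx.1.trans hx.2
  have hy : 0 < (x - (d + 2 * K * √(T - t1))) / √(T - t) + 2 * K := by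
    by_contra hcon
    push Not at hcon
    have e1 : 1 ≤ Real.exp (-((x - (d + 2 * K * √(T - t1))) / √(T - t) + 2 * K)) :=
      Real.one_le_exp (by linarith)
    have e2 : u t x ≤ u t d := hu.anti t ⟨ht0.le, htT⟩ ⟨hd.le, hdR⟩ ⟨hd.le.trans hx.1, hx.2⟩ hx.1
    have e3 := hty t ht.le htT
    have e4 : M ≤ η + M * Real.exp (-((x - (d + 2 * K * √(T - t1))) / √(T - t) + 2 * K)) := by
      nlinarith
    have := mul_le_mul_of_nonneg_left e4 hP.le
    rw [← heq] at this
    linarith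
  have hxd : x ≠ d := by
    intro h
    rw [h] at hy
    have e1 : √(T - t) ≤ √(T - t1) := Real.sqrt_le_sqrt (by linarith)
    have e2 : (d - (d + 2 * K * √(T - t1))) / √(T - t) ≤ - (2 * K) := by
      rw [div_le_iff₀ hsq]
      nlinarith
    linarith
  have hxR : x ≠ R := by
    intro h
    have e1 : 0 < u t x := by rw [heq]; positivity
    rw [h, huR t ⟨ht0, htT⟩] at e1
    exact lt_irrefl _ e1
  have hxI : x ∈ Ioo d R := ⟨lt_of_le_of_ne hx.1 (Ne.symm hxd), lt_of_le_of_ne hx.2 hxR⟩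
  have hx0 : x ∈ Ioo 0 R := ⟨hd.trans hxI.1, hxI.2⟩
  refine ⟨hxI, moving_sup hu hD hk hβ hr hη hM ⟨ht0, htT⟩ hx0 _ rfl (c := c) ?_ ?_⟩
  · have hs3 : c * (T - t) ^ (α + 1) ≤ α * η / 4 := by
      refine le_trans (mul_le_mul_of_nonneg_left ?_ hc.le) h3
      exact Real.rpow_le_rpow hs.le (by linarith) (by linarith)
    have := num_moving hη hM hΛ0 hD hα hp0 hr0 hc h1 h2 hs3 hK hK1 hK2 hy
    convert this using 4
    ring
  · have := hf hx0
    rwa [heq] at this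

lemma moving_cont (t1 t2 a b d R T η M α : ℝ) (ht2 : t2 < T) :
    ContinuousOn (Function.uncurry (fun t x : ℝ => (T - t) ^ (-α) *
      (η + M * Real.exp (-((x - a) / √(T - t) + b))))) (Icc t1 t2 ×ˢ Icc d R) := by
  unfold Function.uncurry
  have hpos : ∀ z ∈ Icc t1 t2 ×ˢ Icc d R, 0 < T - z.1 := by
    rintro ⟨t, x⟩ ⟨h1, _⟩
    have := h1.2
    simp only at this ⊢
    linarith
  refine ContinuousOn.mul (ContinuousOn.rpow_const (by fun_prop) fun z hz => Or.inl (hpos z hz).ne') ?_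
  refine continuousOn_const.add (continuousOn_const.mul ?_)
  refine Real.continuous_exp.comp_continuousOn (ContinuousOn.neg ?_)
  refine ContinuousOn.add (ContinuousOn.div (by fun_prop) (by fun_prop) ?_) continuousOn_const
  intro z hz
  exact (Real.sqrt_pos.2 (hpos z hz)).ne'

lemma step2 {D1 D2 k R T : ℝ} {u v f g : ℝ → ℝ → ℝ} (hu : Sol D1 k R T u f)
    (hv : Sol D2 k R T v g) (hD1 : 0 < D1) (hD2 : 0 < D2)
    (hk : 0 ≤ k) {d η M Λ Λ' K α β p q r s c t1 : ℝ} (hα : 0 < α) (hβ : 0 < β)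
    (hβp : β * p = α + 1) (hαq : α * q = β + 1)
    (hr : α * r = α + 1) (hs : β * s = β + 1) (hp0 : 0 < p) (hq0 : 0 < q) (hr0 : 0 < r)
    (hs0 : 0 < s) (hc : 0 < c) (hd : 0 < d)
    (hη : 0 < η) (hM : 0 < M) (hΛ0 : 0 ≤ Λ) (hΛ0' : 0 ≤ Λ')
    (h1 : c * ((2 * η) ^ p + (2 * η) ^ r) ≤ α * η / 4)
    (h1' : c * ((2 * η) ^ q + (2 * η) ^ s) ≤ β * η / 4)
    (h2 : ∀ z, 0 < z → z ≤ M → c * ((2 * z) ^ p + (2 * z) ^ r) ≤ Λ * z)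
    (h2' : ∀ z, 0 < z → z ≤ M → c * ((2 * z) ^ q + (2 * z) ^ s) ≤ Λ' * z)
    (h3 : c * (T - t1) ^ (α + 1) ≤ α * η / 4)
    (h3' : c * (T - t1) ^ (β + 1) ≤ β * η / 4) (hK : 0 < K) (hK1 : 2 * (D1 + Λ) ≤ K)
    (hK1' : 2 * (D2 + Λ') ≤ K)
    (hK2 : 4 * M ≤ K * (α * η)) (hK2' : 4 * M ≤ K * (β * η)) (ht1 : 0 < t1) (ht1T : t1 < T)
    (hty : ∀ t, t1 ≤ t → t < T → u t d < M * (T - t) ^ (-α))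
    (hty' : ∀ t, t1 ≤ t → t < T → v t d < M * (T - t) ^ (-β))
    (huR : ∀ t ∈ Ioo 0 T, u t R = 0) (hvR : ∀ t ∈ Ioo 0 T, v t R = 0)
    (hf : ∀ t ∈ Ioo 0 T, ∀ x ∈ Ioo 0 R, f t x ≤ c * ((v t x) ^ p + (u t x) ^ r + 1))
    (hg : ∀ t ∈ Ioo 0 T, ∀ x ∈ Ioo 0 R, g t x ≤ c * ((u t x) ^ q + (v t x) ^ s + 1))
    (hiu : (T - t1) ^ α * u t1 d ≤ η) (hiv : (T - t1) ^ β * v t1 d ≤ η) :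
    ∀ t ∈ Ico t1 T, ∀ x ∈ Icc d R,
      u t x < (T - t) ^ (-α) *
        (η + M * Real.exp (-((x - (d + 2 * K * √(T - t1))) / √(T - t) + 2 * K))) ∧
      v t x < (T - t) ^ (-β) *
        (η + M * Real.exp (-((x - (d + 2 * K * √(T - t1))) / √(T - t) + 2 * K))) := by
  intro t2 ht2 x hx
  have hτ : 0 < T - t1 := sub_pos.2 ht1T
  have hinit : ∀ (a : ℝ) (D : ℝ) (w h : ℝ → ℝ → ℝ), Sol D k R T w h → (T - t1) ^ a * w t1 d ≤ η →
      ∀ x ∈ Icc d R, w t1 x < (T - t1) ^ (-a) *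
        (η + M * Real.exp (-((x - (d + 2 * K * √(T - t1))) / √(T - t1) + 2 * K))) := by
    intro a D w h hw hi x hx
    have e2 : w t1 x ≤ w t1 d := hw.anti t1 ⟨ht1.le, ht1T⟩ ⟨hd.le, hx.1.trans hx.2⟩
      ⟨hd.le.trans hx.1, hx.2⟩ hx.1
    have hP : 0 < (T - t1) ^ (-a) := Real.rpow_pos_of_pos hτ _
    have hPP : (T - t1) ^ (-a) * (T - t1) ^ a = 1 := by rw [← Real.rpow_add hτ]; simp
    have e3 := mul_le_mul_of_nonneg_left hi hP.le
    rw [← mul_assoc, hPP, one_mul] at e3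
    have e4 : 0 < (T - t1) ^ (-a) *
      (M * Real.exp (-((x - (d + 2 * K * √(T - t1))) / √(T - t1) + 2 * K))) := by positivity
    linarith
  refine compare_sup (k := k) (t0 := t1) (t2 := t2) (a := d) (b := R) u v
    (fun t x => (T - t) ^ (-α) *
      (η + M * Real.exp (-((x - (d + 2 * K * √(T - t1))) / √(T - t) + 2 * K))))
    (fun t x => (T - t) ^ (-β) *
      (η + M * Real.exp (-((x - (d + 2 * K * √(T - t1))) / √(T - t) + 2 * K)))) hD1 hD2
    (hu.contOn ht1.le ht2.2 hd.le le_rfl) (hv.contOn ht1.le ht2.2 hd.le le_rfl)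
    (moving_cont _ _ _ _ _ _ _ _ _ _ ht2.2) (moving_cont _ _ _ _ _ _ _ _ _ _ ht2.2)
    (hinit α D1 u f hu hiu) (hinit β D2 v g hv hiv) ?_ ?_ t2 ⟨ht2.1, le_rfl⟩ x hx
  · intro t ht x hx heq hle
    have htT : t < T := ht.2.trans_lt ht2.2
    have ht0 : 0 < t := ht1.trans ht.1
    refine step2_side hu hD1 hk hα hβp hr hp0 hr0 hc hd hη hM hΛ0 h1 h2 h3 hK hK1 hK2 ht1 hty huR
      ht.1 htT hx heq ?_
    intro hx0
    refine (hf t ⟨ht0, htT⟩ x hx0).trans ?_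
    have := Real.rpow_le_rpow (hv.nn t ⟨ht0.le, htT⟩ x ⟨hx0.1.le, hx0.2.le⟩) hle hp0.le
    gcongr
  · intro t ht x hx heq hle
    have htT : t < T := ht.2.trans_lt ht2.2
    have ht0 : 0 < t := ht1.trans ht.1
    refine step2_side hv hD2 hk hβ hαq hs hq0 hs0 hc hd hη hM hΛ0' h1' h2' h3' hK hK1' hK2' ht1
      hty' hvR ht.1 htT hx heq ?_
    intro hx0
    refine (hg t ⟨ht0, htT⟩ x hx0).trans ?_
    have := Real.rpow_le_rpow (hu.nn t ⟨ht0.le, htT⟩ x ⟨hx0.1.le, hx0.2.le⟩) hle hq0.le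
    gcongr

lemma step3_side {D k R T : ℝ} {u f : ℝ → ℝ → ℝ} (hu : Sol D k R T u f) (hD : 0 < D)
    (hk : 0 ≤ k) {d e κ η α β p r c t1 : ℝ} (hα : 0 < α) (hβ : β * p = α + 1)
    (hr : α * r = α + 1) (hc : 0 < c) (hd : 0 < d)
    (hκ : 0 < κ) (he : 0 < e) (heD : D * (4 * (α + 1) * e) ≤ 1 / 2)
    (h1 : c * (κ ^ p + κ ^ r) ≤ α * κ / 8)
    (h3 : c * (2 * (T - t1)) ^ (α + 1) ≤ α * κ / 8)
    (hηκ : 2 * η < κ) (heτ : e * (R - d) ^ 2 ≤ T - t1) (ht1 : 0 < t1)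
    (hb : ∀ t, t1 ≤ t → t < T → u t d ≤ (T - t) ^ (-α) * (2 * η))
    (huR : ∀ t ∈ Ioo 0 T, u t R = 0)
    {t x : ℝ} (ht : t1 < t) (htT : t < T) (hx : x ∈ Icc d R)
    (heq : u t x = κ * (T - t + e * (x - d) ^ 2) ^ (-α))
    (hf : x ∈ Ioo 0 R → f t x ≤ c * ((κ * (T - t + e * (x - d) ^ 2) ^ (-β)) ^ p
      + (u t x) ^ r + 1)) :
    x ∈ Ioo d R ∧ SupB D k u (fun t x => κ * (T - t + e * (x - d) ^ 2) ^ (-α)) t x := by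
  have hs : 0 < T - t := sub_pos.2 htT
  have hth : 0 < T - t + e * (x - d) ^ 2 := by positivity
  have hP : 0 < (T - t + e * (x - d) ^ 2) ^ (-α) := Real.rpow_pos_of_pos hth _
  have ht0 : 0 < t := ht1.trans ht
  have hxd : x ≠ d := by
    intro h
    rw [h] at heq hP
    simp only [sub_self, ne_eq, OfNat.ofNat_ne_zero, not_false_eq_true, zero_pow, mul_zero,
      add_zero] at heq hP
    have := hb t ht.le htT
    rw [heq] at this
    have := mul_lt_mul_of_pos_left hηκ hP
    linarith
  have hxR : x ≠ R := by
    intro h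
    have e1 : 0 < u t x := by rw [heq]; positivity
    rw [h, huR t ⟨ht0, htT⟩] at e1
    exact lt_irrefl _ e1
  have hxI : x ∈ Ioo d R := ⟨lt_of_le_of_ne hx.1 (Ne.symm hxd), lt_of_le_of_ne hx.2 hxR⟩
  have hx0 : x ∈ Ioo 0 R := ⟨hd.trans hxI.1, hxI.2⟩
  refine ⟨hxI, theta_sup hu hD hk hα hβ hr hκ he heD ⟨ht0, htT⟩ hx0 hx.1 (c := c) ?_ ?_⟩
  · have e1 : e * (x - d) ^ 2 ≤ e * (R - d) ^ 2 := by
      have : 0 ≤ x - d := by linarith [hx.1]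
      have : x - d ≤ R - d := by linarith [hx.2]
      gcongr
    have e2 : c * (T - t + e * (x - d) ^ 2) ^ (α + 1) ≤ α * κ / 8 := by
      refine le_trans (mul_le_mul_of_nonneg_left ?_ hc.le) h3
      exact Real.rpow_le_rpow hth.le (by linarith) (by linarith)
    have : 0 < α * κ := by positivity
    linarith
  · have := hf hx0
    rwa [heq] at this

lemma theta_cont (t1 t2 e d R T κ α : ℝ) (ht2 : t2 < T) (he : 0 < e) :
    ContinuousOn (Function.uncurry (fun t x : ℝ => κ * (T - t + e * (x - d) ^ 2) ^ (-α)))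
      (Icc t1 t2 ×ˢ Icc d R) := by
  unfold Function.uncurry
  refine continuousOn_const.mul (ContinuousOn.rpow_const (by fun_prop) ?_)
  rintro ⟨t, x⟩ ⟨h1, _⟩
  left
  have := h1.2
  have h2 : 0 < T - t := by simp only at this; linarith
  simp only
  positivity

lemma step3 {D1 D2 k R T : ℝ} {u v f g : ℝ → ℝ → ℝ} (hu : Sol D1 k R T u f)
    (hv : Sol D2 k R T v g) (hD1 : 0 < D1) (hD2 : 0 < D2)
    (hk : 0 ≤ k) {d η κ α β p q r s c t1 : ℝ} (hα : 0 < α) (hβ : 0 < β)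
    (hβp : β * p = α + 1) (hαq : α * q = β + 1)
    (hr : α * r = α + 1) (hs : β * s = β + 1) (hp0 : 0 < p) (hq0 : 0 < q)
    (hc : 0 < c) (hd : 0 < d) (hdR : d < R)
    (hκ : 0 < κ)
    (h1 : c * (κ ^ p + κ ^ r) ≤ α * κ / 8) (h1' : c * (κ ^ q + κ ^ s) ≤ β * κ / 8)
    (h3 : c * (2 * (T - t1)) ^ (α + 1) ≤ α * κ / 8)
    (h3' : c * (2 * (T - t1)) ^ (β + 1) ≤ β * κ / 8)
    (hηκ : 2 * η < κ) (hηκ1 : 2 * η * 2 ^ α < κ) (hηκ2 : 2 * η * 2 ^ β < κ)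
    (ht1 : 0 < t1) (ht1T : t1 < T)
    (hb : ∀ t, t1 ≤ t → t < T → ∀ x ∈ Icc d R, u t x ≤ (T - t) ^ (-α) * (2 * η))
    (hb' : ∀ t, t1 ≤ t → t < T → ∀ x ∈ Icc d R, v t x ≤ (T - t) ^ (-β) * (2 * η))
    (huR : ∀ t ∈ Ioo 0 T, u t R = 0) (hvR : ∀ t ∈ Ioo 0 T, v t R = 0)
    (hf : ∀ t ∈ Ioo 0 T, ∀ x ∈ Ioo 0 R, f t x ≤ c * ((v t x) ^ p + (u t x) ^ r + 1))
    (hg : ∀ t ∈ Ioo 0 T, ∀ x ∈ Ioo 0 R, g t x ≤ c * ((u t x) ^ q + (v t x) ^ s + 1)) :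
    ∃ e > 0, ∀ t ∈ Ico t1 T, ∀ x ∈ Icc d R,
      u t x < κ * (T - t + e * (x - d) ^ 2) ^ (-α) ∧
      v t x < κ * (T - t + e * (x - d) ^ 2) ^ (-β) := by
  have hτ : 0 < T - t1 := sub_pos.2 ht1T
  have hRd : 0 < R - d := sub_pos.2 hdR
  obtain ⟨e, he, heD1, heD2, heτ⟩ : ∃ e > 0, D1 * (4 * (α + 1) * e) ≤ 1 / 2 ∧
      D2 * (4 * (β + 1) * e) ≤ 1 / 2 ∧ e * (R - d) ^ 2 ≤ T - t1 := by
    refine ⟨min (1 / (8 * D1 * (α + 1))) (min (1 / (8 * D2 * (β + 1))) ((T - t1) / (R - d) ^ 2)),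
      ?_, ?_, ?_, ?_⟩
    · refine lt_min ?_ (lt_min ?_ ?_) <;> positivity
    · have : min (1 / (8 * D1 * (α + 1))) (min (1 / (8 * D2 * (β + 1))) ((T - t1) / (R - d) ^ 2))
        ≤ 1 / (8 * D1 * (α + 1)) := min_le_left _ _
      rw [le_div_iff₀ (by positivity)] at this
      linarith
    · have : min (1 / (8 * D1 * (α + 1))) (min (1 / (8 * D2 * (β + 1))) ((T - t1) / (R - d) ^ 2))
        ≤ 1 / (8 * D2 * (β + 1)) := (min_le_right _ _).trans (min_le_left _ _)
      rw [le_div_iff₀ (by positivity)] at this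
      linarith
    · have : min (1 / (8 * D1 * (α + 1))) (min (1 / (8 * D2 * (β + 1))) ((T - t1) / (R - d) ^ 2))
        ≤ (T - t1) / (R - d) ^ 2 := (min_le_right _ _).trans (min_le_right _ _)
      rwa [le_div_iff₀ (by positivity)] at this
  refine ⟨e, he, ?_⟩
  have hinit : ∀ (a : ℝ) (w : ℝ → ℝ → ℝ), 0 < a → 2 * η * 2 ^ a < κ →
      (∀ x ∈ Icc d R, w t1 x ≤ (T - t1) ^ (-a) * (2 * η)) →
      ∀ x ∈ Icc d R, w t1 x < κ * (T - t1 + e * (x - d) ^ 2) ^ (-a) := by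
    intro a w ha hκa hw x hx
    refine (hw x hx).trans_lt ?_
    have e1 : e * (x - d) ^ 2 ≤ e * (R - d) ^ 2 := by
      have : 0 ≤ x - d := by linarith [hx.1]
      have : x - d ≤ R - d := by linarith [hx.2]
      gcongr
    have hth : 0 < T - t1 + e * (x - d) ^ 2 := by positivity
    have e2 : (2 * (T - t1)) ^ (-a) ≤ (T - t1 + e * (x - d) ^ 2) ^ (-a) :=
      Real.rpow_le_rpow_of_nonpos hth (by linarith) (by linarith)
    have e3 : (2 * (T - t1)) ^ (-a) * 2 ^ a = (T - t1) ^ (-a) := by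
      rw [Real.mul_rpow (by norm_num) hτ.le, mul_right_comm, ← Real.rpow_add (by norm_num)]
      simp
    have hpos : 0 < (2 * (T - t1)) ^ (-a) := Real.rpow_pos_of_pos (by positivity) _
    calc (T - t1) ^ (-a) * (2 * η) = (2 * (T - t1)) ^ (-a) * (2 * η * 2 ^ a) := by
          rw [← e3]; ring
      _ < (2 * (T - t1)) ^ (-a) * κ := mul_lt_mul_of_pos_left hκa hpos
      _ ≤ (T - t1 + e * (x - d) ^ 2) ^ (-a) * κ := mul_le_mul_of_nonneg_right e2 hκ.le
      _ = _ := mul_comm _ _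
  intro t2 ht2 x hx
  refine compare_sup (k := k) (t0 := t1) (t2 := t2) (a := d) (b := R) u v
    (fun t x => κ * (T - t + e * (x - d) ^ 2) ^ (-α))
    (fun t x => κ * (T - t + e * (x - d) ^ 2) ^ (-β)) hD1 hD2
    (hu.contOn ht1.le ht2.2 hd.le le_rfl) (hv.contOn ht1.le ht2.2 hd.le le_rfl)
    (theta_cont _ _ _ _ _ _ _ _ ht2.2 he) (theta_cont _ _ _ _ _ _ _ _ ht2.2 he)
    (hinit α u hα hηκ1 (hb t1 le_rfl ht1T)) (hinit β v hβ hηκ2 (hb' t1 le_rfl ht1T))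
    ?_ ?_ t2 ⟨ht2.1, le_rfl⟩ x hx
  · intro t ht x hx heq hle
    have htT : t < T := ht.2.trans_lt ht2.2
    have ht0 : 0 < t := ht1.trans ht.1
    refine step3_side hu hD1 hk hα hβp hr hc hd hκ he heD1 h1 h3 hηκ heτ ht1
      (fun t h1 h2 => hb t h1 h2 d ⟨le_rfl, hdR.le⟩) huR ht.1 htT hx heq ?_
    intro hx0
    refine (hf t ⟨ht0, htT⟩ x hx0).trans ?_
    have := Real.rpow_le_rpow (hv.nn t ⟨ht0.le, htT⟩ x ⟨hx0.1.le, hx0.2.le⟩) hle hp0.le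
    gcongr
  · intro t ht x hx heq hle
    have htT : t < T := ht.2.trans_lt ht2.2
    have ht0 : 0 < t := ht1.trans ht.1
    refine step3_side hv hD2 hk hβ hαq hs hc hd hκ he heD2 h1' h3' hηκ heτ ht1
      (fun t h1 h2 => hb' t h1 h2 d ⟨le_rfl, hdR.le⟩) hvR ht.1 htT hx heq ?_
    intro hx0
    refine (hg t ⟨ht0, htT⟩ x hx0).trans ?_
    have := Real.rpow_le_rpow (hu.nn t ⟨ht0.le, htT⟩ x ⟨hx0.1.le, hx0.2.le⟩) hle hq0.le
    gcongr

lemma exp_small {x d d2 K M η τ τ0 s : ℝ} (hM : 0 < M) (hη : 0 < η) (hK : 0 < K)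
    (hs : 0 < s) (hsτ : s ≤ τ) (hτ : τ ≤ τ0) (h1 : 4 * K * √τ0 ≤ d2 - d)
    (h2 : 2 * M * √τ0 ≤ (d2 - d) * η) (hx : d2 ≤ x) :
    M * Real.exp (-((x - (d + 2 * K * √τ)) / √s + 2 * K)) ≤ η := by
  have hs' : 0 < √s := Real.sqrt_pos.2 hs
  have i1 : √s ≤ √τ0 := Real.sqrt_le_sqrt (hsτ.trans hτ)
  have i2 : √τ ≤ √τ0 := Real.sqrt_le_sqrt hτ
  have i3 : K * √τ ≤ K * √τ0 := mul_le_mul_of_nonneg_left i2 hK.le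
  have i4 : M / η ≤ (x - (d + 2 * K * √τ)) / √s := by
    rw [div_le_div_iff₀ hη hs']
    have : M * √s ≤ M * √τ0 := mul_le_mul_of_nonneg_left i1 hM.le
    have : (d2 - d) / 2 * η ≤ (x - (d + 2 * K * √τ)) * η :=
      mul_le_mul_of_nonneg_right (by linarith) hη.le
    linarith
  have i5 : M / η ≤ Real.exp ((x - (d + 2 * K * √τ)) / √s + 2 * K) := by
    have := Real.add_one_le_exp ((x - (d + 2 * K * √τ)) / √s + 2 * K)
    linarith
  rw [Real.exp_neg, ← div_eq_mul_inv, div_le_iff₀ (Real.exp_pos _)]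
  rw [div_le_iff₀ hη] at i5
  linarith

/-- Non-degeneracy criterion for blow-up points: for `0 < d₁ < d₀ < R` there exist
`η, τ₀ > 0`, depending only on `p, q, δ, c₁, c₂, d₀, d₁, n, R, T`, such that for
every radially decreasing solution of the general system: if at some time
`t₁ ∈ [T-τ₀, T)` one has `(T-t₁)^α u(t₁,d₁) ≤ η` and `(T-t₁)^β v(t₁,d₁) ≤ η`,
then `u + v` is bounded on a backward space-time neighborhood of `(T, d₀)`,
i.e. `d₀` is not a blow-up point. -/
theorem nondegeneracy_criterion
    (n : ℕ) (hn : 1 ≤ n) (R : ℝ) (hR : 0 < R)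
    (p q δ : ℝ) (hp : 1 < p) (hq : 1 < q) (hδ : 0 < δ)
    (c₁ c₂ : ℝ) (hc₁ : 0 < c₁) (hc₂ : 0 < c₂)
    (T : ℝ) (hT : 0 < T)
    (d₀ d₁ : ℝ) (hd₁ : 0 < d₁) (hd₁₀ : d₁ < d₀) (hd₀ : d₀ < R) :
    ∃ η > (0:ℝ), ∃ τ₀ > (0:ℝ), ∀ F G u v : ℝ → ℝ → ℝ,
      ContDiff ℝ 1 (Function.uncurry F) →
      ContDiff ℝ 1 (Function.uncurry G) →
      (∀ a b : ℝ, 0 ≤ a → 0 ≤ b → 0 ≤ deriv (fun y => F a y) b) →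
      (∀ a b : ℝ, 0 ≤ a → 0 ≤ b → 0 ≤ deriv (fun x => G x b) a) →
      (∀ a b : ℝ, 0 ≤ a → 0 ≤ b → c₁ * b ^ p ≤ F a b) →
      (∀ a b : ℝ, 0 ≤ a → 0 ≤ b →
        F a b ≤ c₂ * (b ^ p + a ^ (p * (q + 1) / (p + 1)) + 1)) →
      (∀ a b : ℝ, 0 ≤ a → 0 ≤ b → c₁ * a ^ q ≤ G a b) →
      (∀ a b : ℝ, 0 ≤ a → 0 ≤ b →
        G a b ≤ c₂ * (a ^ q + b ^ (q * (p + 1) / (q + 1)) + 1)) →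
      (∀ t ∈ Ico (0:ℝ) T, ∀ ρ ∈ Icc (0:ℝ) R, 0 ≤ u t ρ) →
      (∀ t ∈ Ico (0:ℝ) T, ∀ ρ ∈ Icc (0:ℝ) R, 0 ≤ v t ρ) →
      ContinuousOn (Function.uncurry u) (Ico (0:ℝ) T ×ˢ Icc (0:ℝ) R) →
      ContinuousOn (Function.uncurry v) (Ico (0:ℝ) T ×ˢ Icc (0:ℝ) R) →
      (∀ t ∈ Ioo (0:ℝ) T, ContDiffOn ℝ 2 (u t) (Ioo (0:ℝ) R)) →
      (∀ t ∈ Ioo (0:ℝ) T, ContDiffOn ℝ 2 (v t) (Ioo (0:ℝ) R)) →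
      (∀ ρ ∈ Ioo (0:ℝ) R, ∀ t ∈ Ioo (0:ℝ) T, DifferentiableAt ℝ (fun s => u s ρ) t) →
      (∀ ρ ∈ Ioo (0:ℝ) R, ∀ t ∈ Ioo (0:ℝ) T, DifferentiableAt ℝ (fun s => v s ρ) t) →
      (∀ t ∈ Ioo (0:ℝ) T, u t R = 0) →
      (∀ t ∈ Ioo (0:ℝ) T, v t R = 0) →
      (∀ t ∈ Ico (0:ℝ) T, AntitoneOn (u t) (Icc (0:ℝ) R)) →
      (∀ t ∈ Ico (0:ℝ) T, AntitoneOn (v t) (Icc (0:ℝ) R)) →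
      (∀ t ∈ Ioo (0:ℝ) T, ∀ ρ ∈ Ioo (0:ℝ) R,
        deriv (fun s => u s ρ) t
          = δ * (deriv (deriv (u t)) ρ + ((n : ℝ) - 1) / ρ * deriv (u t) ρ)
            + F (u t ρ) (v t ρ)) →
      (∀ t ∈ Ioo (0:ℝ) T, ∀ ρ ∈ Ioo (0:ℝ) R,
        deriv (fun s => v s ρ) t
          = deriv (deriv (v t)) ρ + ((n : ℝ) - 1) / ρ * deriv (v t) ρ
            + G (u t ρ) (v t ρ)) →
      ∀ t₁ : ℝ, T - τ₀ ≤ t₁ → t₁ < T →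
        (T - t₁) ^ ((p + 1) / (p * q - 1)) * u t₁ d₁ ≤ η →
        (T - t₁) ^ ((q + 1) / (p * q - 1)) * v t₁ d₁ ≤ η →
        ∃ ε > (0:ℝ), ∃ C : ℝ, ∀ t ρ : ℝ,
          T - ε < t → t < T → ρ ∈ Icc (0:ℝ) R → |ρ - d₀| < ε →
            u t ρ + v t ρ ≤ C := by
  have hpq : 0 < p * q - 1 := by nlinarith
  have hp1 : 0 < p + 1 := by linarith
  have hq1 : 0 < q + 1 := by linarith
  have hne : q * p - 1 ≠ 0 := by rw [mul_comm]; exact hpq.ne'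
  have hk : 0 ≤ (n:ℝ) - 1 := by
    have : (1:ℝ) ≤ n := by exact_mod_cast hn
    linarith
  have hα : 0 < (p + 1) / (p * q - 1) := by positivity
  have hβ : 0 < (q + 1) / (p * q - 1) := by positivity
  have hβp : (q + 1) / (p * q - 1) * p = (p + 1) / (p * q - 1) + 1 := by field_simp; ring
  have hαq : (p + 1) / (p * q - 1) * q = (q + 1) / (p * q - 1) + 1 := by field_simp; ring
  have hαr : (p + 1) / (p * q - 1) * (p * (q + 1) / (p + 1)) = (p + 1) / (p * q - 1) + 1 := by
    field_simp; ring
  have hβs : (q + 1) / (p * q - 1) * (q * (p + 1) / (q + 1)) = (q + 1) / (p * q - 1) + 1 := by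
    field_simp; ring
  have hr : 1 < p * (q + 1) / (p + 1) := by rw [lt_div_iff₀ hp1]; nlinarith
  have hs : 1 < q * (p + 1) / (q + 1) := by rw [lt_div_iff₀ hq1]; nlinarith
  clear hne
  generalize (p + 1) / (p * q - 1) = α at *
  generalize (q + 1) / (p * q - 1) = β at *
  generalize p * (q + 1) / (p + 1) = r at *
  generalize q * (p + 1) / (q + 1) = s at *
  obtain ⟨Mu, τu, hτu, hτuT, Hu⟩ := typeI δ 1 ((n:ℝ) - 1) R T α β p q c₁ d₁ hδ one_pos hk hT hα hβ
    hp hq hβp hαq hc₁ hd₁ (hd₁₀.trans hd₀)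
  obtain ⟨Mv, τv, hτv, hτvT, Hv⟩ := typeI 1 δ ((n:ℝ) - 1) R T β α q p c₁ d₁ one_pos hδ hk hT hβ hα
    hq hp hαq hβp hc₁ hd₁ (hd₁₀.trans hd₀)
  obtain ⟨M, hMu, hMv, hM⟩ : ∃ M, Mu ≤ M ∧ Mv ≤ M ∧ 0 < M :=
    ((eventually_ge_atTop Mu).and ((eventually_ge_atTop Mv).and (eventually_gt_atTop 0))).exists
  obtain ⟨Λ, hΛ0, hΛ⟩ := large_lin p r c₂ M hp hr hc₂
  obtain ⟨Λ', hΛ0', hΛ'⟩ := large_lin q s c₂ M hq hs hc₂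
  obtain ⟨κ, hκ1, hκ2, hκ⟩ := ((small_rpow p r c₂ (α / 8) 1 hp hr (by positivity) one_pos).and
    ((small_rpow q s c₂ (β / 8) 1 hq hs (by positivity) one_pos).and
      (self_mem_nhdsWithin : Ioi (0:ℝ) ∈ 𝓝[>] 0))).exists
  have hκ : 0 < κ := hκ
  rw [one_mul] at hκ1 hκ2
  have small : ∀ φ : ℝ → ℝ, Continuous φ → φ 0 = 0 → ∀ B > 0, ∀ᶠ z in 𝓝[>] (0:ℝ), φ z < B := by
    intro φ hφ h0 B hB
    have := hφ.tendsto 0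
    rw [h0] at this
    exact (this.mono_left nhdsWithin_le_nhds).eventually (gt_mem_nhds hB)
  obtain ⟨η, hη1, hη2, hη3, hη4, hη5, hη⟩ :=
    ((small_rpow p r c₂ (α / 4) 2 hp hr (by positivity) two_pos).and
    ((small_rpow q s c₂ (β / 4) 2 hq hs (by positivity) two_pos).and
    ((small (fun z => 2 * z) (by fun_prop) (by simp) κ hκ).and
    ((small (fun z => 2 * z * 2 ^ α) (by fun_prop) (by simp) κ hκ).and
    ((small (fun z => 2 * z * 2 ^ β) (by fun_prop) (by simp) κ hκ).and
      (self_mem_nhdsWithin : Ioi (0:ℝ) ∈ 𝓝[>] 0)))))).exists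
  have hη : 0 < η := hη
  obtain ⟨K, hK1, hK2, hK3, hK4, hK⟩ : ∃ K, 2 * (δ + Λ) ≤ K ∧ 2 * (1 + Λ') ≤ K ∧
      4 * M / (α * η) ≤ K ∧ 4 * M / (β * η) ≤ K ∧ 0 < K :=
    ((eventually_ge_atTop _).and ((eventually_ge_atTop _).and ((eventually_ge_atTop _).and
      ((eventually_ge_atTop _).and (eventually_gt_atTop 0))))).exists
  rw [div_le_iff₀ (by positivity)] at hK3 hK4
  obtain ⟨d₂, hd₂⟩ : ∃ d₂, d₂ = (d₁ + d₀) / 2 := ⟨_, rfl⟩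
  have hd12 : 0 < d₂ - d₁ := by linarith
  have hd20 : 0 < d₀ - d₂ := by linarith
  have cr : ∀ a : ℝ, 0 < a → Continuous (fun z : ℝ => z ^ (a + 1)) := fun a ha =>
    Real.continuous_rpow_const (by linarith)
  have zr : ∀ a : ℝ, 0 < a → (0:ℝ) ^ (a + 1) = 0 := fun a ha => Real.zero_rpow (by linarith)
  obtain ⟨τ₀, a1, a2, a3, a4, a5, a6, a7, a8, hτ₀⟩ :=
    ((small (fun z => z) (by fun_prop) rfl _ hτu).and
    ((small (fun z => z) (by fun_prop) rfl _ hτv).and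
    ((small (fun z => c₂ * z ^ (α + 1)) ((cr α hα).const_mul c₂) (by simp [zr α hα])
      (α * η / 4) (by positivity)).and
    ((small (fun z => c₂ * z ^ (β + 1)) ((cr β hβ).const_mul c₂) (by simp [zr β hβ])
      (β * η / 4) (by positivity)).and
    ((small (fun z => c₂ * (2 * z) ^ (α + 1)) (((cr α hα).comp (continuous_const_mul 2)).const_mul c₂)
      (by simp [zr α hα]) (α * κ / 8) (by positivity)).and
    ((small (fun z => c₂ * (2 * z) ^ (β + 1)) (((cr β hβ).comp (continuous_const_mul 2)).const_mul c₂)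
      (by simp [zr β hβ]) (β * κ / 8) (by positivity)).and
    ((small (fun z => 4 * K * √z) (by fun_prop) (by simp) (d₂ - d₁) hd12).and
    ((small (fun z => 2 * M * √z) (by fun_prop) (by simp) ((d₂ - d₁) * η) (by positivity)).and
      (self_mem_nhdsWithin : Ioi (0:ℝ) ∈ 𝓝[>] 0))))))))).exists
  have hτ₀ : 0 < τ₀ := hτ₀
  refine ⟨η, hη, τ₀, hτ₀, ?_⟩
  intro F G u v _ _ _ _ hF1 hF2 hG1 hG2 hu0 hv0 huc hvc hu2 hv2 hut hvt huR hvR hua hva hup hvp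
    t₁ ht₁ ht₁T hiu hiv
  have su : Sol δ ((n:ℝ) - 1) R T u (fun t x => F (u t x) (v t x)) :=
    ⟨hu0, huc, hu2, hut, hua, hup⟩
  have sv : Sol 1 ((n:ℝ) - 1) R T v (fun t x => G (u t x) (v t x)) :=
    ⟨hv0, hvc, hv2, hvt, hva, fun t ht ρ hρ => by rw [hvp t ht ρ hρ, one_mul]⟩
  have nu : ∀ t ∈ Ioo (0:ℝ) T, ∀ x ∈ Ioo (0:ℝ) R, 0 ≤ u t x := fun t ht x hx =>
    hu0 t ⟨ht.1.le, ht.2⟩ x ⟨hx.1.le, hx.2.le⟩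
  have nv : ∀ t ∈ Ioo (0:ℝ) T, ∀ x ∈ Ioo (0:ℝ) R, 0 ≤ v t x := fun t ht x hx =>
    hv0 t ⟨ht.1.le, ht.2⟩ x ⟨hx.1.le, hx.2.le⟩
  have lf : ∀ t ∈ Ioo (0:ℝ) T, ∀ x ∈ Ioo (0:ℝ) R, c₁ * (v t x) ^ p ≤ F (u t x) (v t x) :=
    fun t ht x hx => hF1 _ _ (nu t ht x hx) (nv t ht x hx)
  have lg : ∀ t ∈ Ioo (0:ℝ) T, ∀ x ∈ Ioo (0:ℝ) R, c₁ * (u t x) ^ q ≤ G (u t x) (v t x) :=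
    fun t ht x hx => hG1 _ _ (nu t ht x hx) (nv t ht x hx)
  have uf : ∀ t ∈ Ioo (0:ℝ) T, ∀ x ∈ Ioo (0:ℝ) R,
      F (u t x) (v t x) ≤ c₂ * ((v t x) ^ p + (u t x) ^ r + 1) :=
    fun t ht x hx => hF2 _ _ (nu t ht x hx) (nv t ht x hx)
  have ug : ∀ t ∈ Ioo (0:ℝ) T, ∀ x ∈ Ioo (0:ℝ) R,
      G (u t x) (v t x) ≤ c₂ * ((u t x) ^ q + (v t x) ^ s + 1) :=
    fun t ht x hx => hG2 _ _ (nu t ht x hx) (nv t ht x hx)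
  have hτ : 0 < T - t₁ := by linarith
  have hττ : T - t₁ ≤ τ₀ := by linarith
  have ht₁0 : 0 < t₁ := by linarith
  have mono : ∀ a : ℝ, 0 < a → c₂ * (T - t₁) ^ (a + 1) ≤ c₂ * τ₀ ^ (a + 1) := fun a ha =>
    mul_le_mul_of_nonneg_left (Real.rpow_le_rpow hτ.le hττ (by linarith)) hc₂.le
  have mono2 : ∀ a : ℝ, 0 < a → c₂ * (2 * (T - t₁)) ^ (a + 1) ≤ c₂ * (2 * τ₀) ^ (a + 1) := fun a ha =>
    mul_le_mul_of_nonneg_left (Real.rpow_le_rpow (by linarith) (by linarith) (by linarith)) hc₂.le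
  have S2 := step2 su sv hδ one_pos hk hα hβ hβp hαq hαr hβs (by linarith : 0 < p)
    (by linarith : 0 < q) (by linarith : 0 < r) (by linarith : 0 < s) hc₂ hd₁ hη hM hΛ0 hΛ0'
    (by linarith) (by linarith) hΛ hΛ' (t1 := t₁) ((mono α hα).trans (a3.le))
    ((mono β hβ).trans (a4.le)) hK hK1 hK2 hK3 hK4 ht₁0 ht₁T
    (fun t h1 h2 => Hu u v _ _ su sv lf lg M hMu t (by linarith) h2)
    (fun t h1 h2 => Hv v u _ _ sv su lg lf M hMv t (by linarith) h2)
    huR hvR uf ug hiu hiv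
  have S2' : ∀ t, t₁ ≤ t → t < T → ∀ x ∈ Icc d₂ R,
      u t x ≤ (T - t) ^ (-α) * (2 * η) ∧ v t x ≤ (T - t) ^ (-β) * (2 * η) := by
    intro t h1 h2 x hx
    obtain ⟨b1, b2⟩ := S2 t ⟨h1, h2⟩ x ⟨by linarith [hx.1], hx.2⟩
    have b3 := exp_small (d := d₁) hM hη hK (sub_pos.2 h2) (by linarith : T - t ≤ T - t₁) hττ
      a7.le a8.le hx.1
    refine ⟨b1.le.trans (mul_le_mul_of_nonneg_left (by linarith) ?_),
      b2.le.trans (mul_le_mul_of_nonneg_left (by linarith) ?_)⟩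
    · exact Real.rpow_nonneg (by linarith) _
    · exact Real.rpow_nonneg (by linarith) _
  obtain ⟨e, he, S3⟩ := step3 su sv hδ one_pos hk (d := d₂) (η := η) (κ := κ) (t1 := t₁)
    hα hβ hβp hαq hαr hβs (by linarith) (by linarith)
    hc₂ (by linarith) (by linarith) hκ (by linarith) (by linarith) ((mono2 α hα).trans a5.le)
    ((mono2 β hβ).trans a6.le) hη3 hη4 hη5 ht₁0 ht₁T
    (fun t h1 h2 x hx => (S2' t h1 h2 x hx).1) (fun t h1 h2 x hx => (S2' t h1 h2 x hx).2)
    huR hvR uf ug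
  obtain ⟨w, hw⟩ : ∃ w, w = (d₀ - d₂) / 2 := ⟨_, rfl⟩
  have hw0 : 0 < w := by linarith
  refine ⟨min w (T - t₁), lt_min hw0 hτ,
    κ * (e * w ^ 2) ^ (-α) + κ * (e * w ^ 2) ^ (-β), ?_⟩
  intro t ρ h1 h2 hρ h3
  have h4 := min_le_left w (T - t₁)
  have h5 := min_le_right w (T - t₁)
  have h6 := (abs_lt.1 h3).1
  obtain ⟨b1, b2⟩ := S3 t ⟨by linarith, h2⟩ ρ ⟨by linarith, hρ.2⟩
  have hwp : 0 < e * w ^ 2 := by positivity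
  have h7 : e * w ^ 2 ≤ T - t + e * (ρ - d₂) ^ 2 := by
    have : w ^ 2 ≤ (ρ - d₂) ^ 2 := pow_le_pow_left₀ hw0.le (by linarith) 2
    have := mul_le_mul_of_nonneg_left this he.le
    linarith
  have h8 := mul_le_mul_of_nonneg_left
    (Real.rpow_le_rpow_of_nonpos hwp h7 (by linarith : -α ≤ 0)) hκ.le
  have h9 := mul_le_mul_of_nonneg_left
    (Real.rpow_le_rpow_of_nonpos hwp h7 (by linarith : -β ≤ 0)) hκ.le
  linarith
end
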